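/- arXiv:2006.04676 — 2 statements merged into one kernel-verified Lean document; each statement's English description precedes it below -/
import Mathlib

section
/- Let a, b ∈ ℕ with b ≥ 1, a ∈ {b, b+1}, and write ab = n(n+1)/2 + i₀ with 0 ≤ i₀ ≤ n; assume i₀ ≤ b whenever a = b. Then there exist matrices A₁,…,A_{i₀-1}, A_{i₀}, A'_{i₀}, A_{i₀+1},…,A_n ∈ M_{a×2}(𝕂) and B₁,…,B_n ∈ M_{2×b}(𝕂) such that the ab products {A_i B_j : 1 ≤ j ≤ i ≤ n} ∪ {A'_{i₀} B_j : 1 ≤ j ≤ i₀} form a basis of M_{a×b}(𝕂). -/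
open Finset

/-- target sums: label 0 gets `r`, labels `1..β/2` get `M`, the half label gets `M/2`. -/
def mpbTgt (M β r i : ℕ) : ℕ :=
  if i = 0 then r else if 2 * i ≤ β then M else if 2 * i = β + 1 then M / 2 else 0

lemma mpb_fold_sum (m z t : ℕ) :
    ∑ u ∈ range z, (if min (u+1) (z-u) = t then m+u+1 else 0)
      = if t = 0 then 0 else if 2*t ≤ z then 2*m+z+1 else if 2*t = z+1 then m+t else 0 := by
  by_cases h0 : t = 0
  · rw [if_pos h0]
    apply Finset.sum_eq_zero
    intro u hu
    rw [Finset.mem_range] at hu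
    rw [if_neg]; omega
  rw [if_neg h0]
  by_cases h1 : 2*t ≤ z
  · rw [if_pos h1]
    have : ∀ u ∈ range z, (if min (u+1) (z-u) = t then m+u+1 else 0)
        = (if u = t-1 then m+t else 0) + (if u = z-t then m+(z-t)+1 else 0) := by
      intro u hu
      rw [Finset.mem_range] at hu
      split_ifs <;> omega
    rw [Finset.sum_congr rfl this, Finset.sum_add_distrib, Finset.sum_ite_eq', Finset.sum_ite_eq',
      if_pos (by rw [Finset.mem_range]; omega), if_pos (by rw [Finset.mem_range]; omega)]
    omega
  rw [if_neg h1]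
  by_cases h2 : 2*t = z+1
  · rw [if_pos h2]
    have : ∀ u ∈ range z, (if min (u+1) (z-u) = t then m+u+1 else 0)
        = (if u = t-1 then m+t else 0) := by
      intro u hu
      rw [Finset.mem_range] at hu
      split_ifs <;> omega
    rw [Finset.sum_congr rfl this, Finset.sum_ite_eq', if_pos (by rw [Finset.mem_range]; omega)]
  · rw [if_neg h2]
    apply Finset.sum_eq_zero
    intro u hu
    rw [Finset.mem_range] at hu
    rw [if_neg]; omega

lemma mpb_split_sum (n' z i : ℕ) (f g : ℕ → ℕ) :
    ∑ x ∈ range (n'+z), (if (if x+1 ≤ n' then f (x+1) else g (x+1)) = i then x+1 else 0)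
     = ∑ x ∈ range n', (if f (x+1) = i then x+1 else 0)
      + ∑ u ∈ range z, (if g (n'+u+1) = i then n'+u+1 else 0) := by
  rw [Finset.sum_range_add]
  congr 1
  · apply Finset.sum_congr rfl
    intro x hx
    rw [Finset.mem_range] at hx
    rw [if_pos (show x+1 ≤ n' by omega)]
  · apply Finset.sum_congr rfl
    intro x hx
    rw [if_neg (show ¬ (n'+x+1 ≤ n') by omega)]

lemma mpb_shift_sum (n' s i : ℕ) (f : ℕ → ℕ) :
    ∑ x ∈ range n', (if (if f (x+1) = 0 then 0 else f (x+1) + s) = i then x+1 else 0)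
     = if i = 0 then ∑ x ∈ range n', (if f (x+1) = 0 then x+1 else 0)
       else if i ≤ s then 0 else ∑ x ∈ range n', (if f (x+1) = i - s then x+1 else 0) := by
  split_ifs with h1 h2
  · apply Finset.sum_congr rfl
    intro x _
    split_ifs <;> omega
  · apply Finset.sum_eq_zero
    intro x _
    split_ifs <;> omega
  · apply Finset.sum_congr rfl
    intro x _
    split_ifs <;> omega

set_option maxHeartbeats 4000000 in
theorem mpb_partition (n : ℕ) : ∀ M β r : ℕ, n*(n+1) = M*β+2*r → (β % 2 = 1 → M % 2 = 0) →
    (n ≤ M ∨ (n ≤ M+1 ∧ n ≤ r)) →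
    ∃ f : ℕ → ℕ, ∀ i, ∑ x ∈ range n, (if f (x+1) = i then x+1 else 0) = mpbTgt M β r i := by
  induction n using Nat.strong_induction_on with
  | _ n ih =>
  intro M β r h hpar hinv
  rcases Nat.eq_zero_or_pos n with hn | hn
  · subst hn
    refine ⟨fun _ => 0, fun i => ?_⟩
    have hr : r = 0 := by omega
    have hM : M * β = 0 := by omega
    rw [Finset.range_zero, Finset.sum_empty]
    unfold mpbTgt
    rcases Nat.mul_eq_zero.mp hM with h1 | h1
    · subst h1; subst hr; split_ifs <;> rfl
    · subst h1; subst hr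
      split_ifs <;> omega
  by_cases hrn : n ≤ r
  · -- feed
    obtain ⟨f, hf⟩ := ih (n-1) (by omega) M β (r-n) (by
      obtain ⟨k, rfl⟩ : ∃ k, n = k+1 := ⟨n-1, by omega⟩
      obtain ⟨q, rfl⟩ : ∃ q, r = k+1+q := ⟨r-(k+1), by omega⟩
      simp only [Nat.add_sub_cancel, Nat.add_sub_cancel_left]
      nlinarith) hpar (by omega)
    refine ⟨fun x => if x ≤ n-1 then f x else 0, fun i => ?_⟩
    have := mpb_split_sum (n-1) 1 i f (fun _ => 0)
    rw [show n-1+1 = n by omega] at this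
    rw [this, hf]
    simp only [Finset.sum_range_one, mpbTgt]
    split_ifs <;> omega
  have hMn : n ≤ M := by omega
  have hrn' : r < n := by omega
  have hβ : 1 ≤ β := by
    rcases Nat.eq_zero_or_pos β with h0 | h0
    · subst h0; nlinarith
    · exact h0
  by_cases hMeq : M = n
  · subst hMeq
    have hβ2 : 2 ≤ β := by
      by_contra hc
      have : β = 1 := by omega
      subst this
      have := hpar rfl
      nlinarith
    obtain ⟨f, hf⟩ := ih (M-1) (by omega) M (β-2) r (by
      obtain ⟨k, rfl⟩ : ∃ k, M = k+1 := ⟨M-1, by omega⟩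
      obtain ⟨q, rfl⟩ : ∃ q, β = q+2 := ⟨β-2, by omega⟩
      simp only [Nat.add_sub_cancel]
      nlinarith) (by intro; apply hpar; omega) (by omega)
    refine ⟨fun x => if x ≤ M-1 then (if f x = 0 then 0 else f x + 1) else 1, fun i => ?_⟩
    have := mpb_split_sum (M-1) 1 i (fun x => if f x = 0 then 0 else f x + 1) (fun _ => 1)
    rw [show M-1+1 = M by omega] at this
    rw [this, mpb_shift_sum, hf, hf]
    simp only [Finset.sum_range_one, mpbTgt]
    split_ifs <;> omega
  by_cases hM2 : M ≤ 2*n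
  · -- zone
    obtain ⟨n', hn'⟩ : ∃ n', M = n + n' + 1 := ⟨M-n-1, by omega⟩
    obtain ⟨z, hz⟩ : ∃ z, n = n' + z := ⟨n-n', by omega⟩
    have hz1 : 1 ≤ z := by omega
    have hMz : M = 2*n'+z+1 := by omega
    have key : n'*(n'+1) + M*z = M*β+2*r := by
      rw [← h, hMz, hz]; ring
    rcases le_or_gt z β with hzb | hzb
    · obtain ⟨β', hβ'⟩ : ∃ β', β = β' + z := ⟨β-z, by omega⟩
      obtain ⟨f, hf⟩ := ih n' (by omega) M β' r (by
        rw [hβ'] at key; nlinarith) (by intro; by_contra hc; omega) (by omega)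
      refine ⟨fun x => if x ≤ n' then (if f x = 0 then 0 else f x + z/2) else
        (if 2 * min (x - n') (z - (x - n' - 1)) ≤ z then min (x - n') (z - (x - n' - 1))
          else z/2+β'/2+1), fun i => ?_⟩
      rw [hz]
      have hsp := mpb_split_sum n' z i (fun x => if f x = 0 then 0 else f x + z/2)
        (fun x => (if 2 * min (x - n') (z - (x - n' - 1)) ≤ z then min (x - n') (z - (x - n' - 1))
          else z/2+β'/2+1))
      rw [hsp, mpb_shift_sum, hf, hf]
      have e1 : ∀ u ∈ range z, (if (if 2 * min (n'+u+1 - n') (z - (n'+u+1 - n' - 1)) ≤ z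
            then min (n'+u+1 - n') (z - (n'+u+1 - n' - 1)) else z/2+β'/2+1) = i
            then n'+u+1 else 0)
          = (if 2 * i ≤ z then (if min (u+1) (z-u) = i then n'+u+1 else 0) else 0)
            + (if i = z/2+β'/2+1 ∧ z % 2 = 1 then
              (if min (u+1) (z-u) = z/2+1 then n'+u+1 else 0) else 0) := by
        intro u hu
        rw [Finset.mem_range] at hu
        rw [show n'+u+1-n' = u+1 by omega, show u+1-1 = u by omega]
        split_ifs <;> omega
      rw [Finset.sum_congr rfl e1, Finset.sum_add_distrib]
      have e2 : ∑ u ∈ range z, (if 2 * i ≤ z then (if min (u+1) (z-u) = i then n'+u+1 else 0) else 0)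
         = if 2 * i ≤ z then (if i = 0 then 0 else M) else 0 := by
        split_ifs with a1 a2
        · rw [mpb_fold_sum, if_pos a2]
        · rw [mpb_fold_sum, if_neg a2, if_pos a1]; omega
        · simp
      have e3 : ∑ u ∈ range z, (if i = z/2+β'/2+1 ∧ z % 2 = 1 then
              (if min (u+1) (z-u) = z/2+1 then n'+u+1 else 0) else 0)
         = if i = z/2+β'/2+1 ∧ z % 2 = 1 then M/2 else 0 := by
        split_ifs with a1
        · rw [mpb_fold_sum, if_neg (by omega), if_neg (by omega), if_pos (by omega)]; omega
        · simp
      rw [e2, e3]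
      unfold mpbTgt
      clear e1 e2 e3 hf ih h key
      split_ifs <;> omega
    · -- terminal
      have hzβ : z = β + 1 := by
        obtain ⟨q, rfl⟩ : ∃ q, z = β + 1 + q := ⟨z-β-1, by omega⟩
        rcases Nat.eq_zero_or_pos q with h0 | h0
        · omega
        · exfalso
          have : M * q ≥ M := Nat.le_mul_of_pos_right _ h0
          nlinarith [Nat.zero_le (n'*(n'+1))]
      have hr : 2*r = n'*(n'+1) + M := by
        rw [hzβ] at key; nlinarith
      have hβe : β % 2 = 0 := by
        by_contra hc
        have := hpar (by omega)
        omega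
      refine ⟨fun x => if x ≤ n' then 0 else
        (if 2 * min (x - n') (z - (x - n' - 1)) ≤ z then min (x - n') (z - (x - n' - 1))
          else 0), fun i => ?_⟩
      rw [hz]
      have := mpb_split_sum n' z i (fun _ => 0) (fun x => (if 2 * min (x - n') (z - (x - n' - 1)) ≤ z
        then min (x - n') (z - (x - n' - 1)) else 0))
      rw [this]
      have e1 : ∀ u ∈ range z, (if (if 2 * min (n'+u+1 - n') (z - (n'+u+1 - n' - 1)) ≤ z
            then min (n'+u+1 - n') (z - (n'+u+1 - n' - 1)) else 0) = i
            then n'+u+1 else 0)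
          = (if 2 * i ≤ z then (if min (u+1) (z-u) = i then n'+u+1 else 0) else 0)
            + (if i = 0 then
              (if min (u+1) (z-u) = z/2+1 then n'+u+1 else 0) else 0) := by
        intro u hu
        rw [Finset.mem_range] at hu
        rw [show n'+u+1-n' = u+1 by omega, show u+1-1 = u by omega]
        split_ifs <;> omega
      rw [Finset.sum_congr rfl e1, Finset.sum_add_distrib]
      have e2 : ∑ u ∈ range z, (if 2 * i ≤ z then (if min (u+1) (z-u) = i then n'+u+1 else 0) else 0)
         = if 2 * i ≤ z then (if i = 0 then 0 else M) else 0 := by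
        split_ifs with a1 a2
        · rw [mpb_fold_sum, if_pos a2]
        · rw [mpb_fold_sum, if_neg a2, if_pos a1]; omega
        · simp
      have e3 : ∑ u ∈ range z, (if i = 0 then
              (if min (u+1) (z-u) = z/2+1 then n'+u+1 else 0) else 0)
         = if i = 0 then M/2 else 0 := by
        split_ifs with a1
        · rw [mpb_fold_sum, if_neg (by omega), if_neg (by omega), if_pos (by omega)]; omega
        · simp
      have e4 : ∑ x ∈ range n', (if 0 = i then x+1 else 0) = if i = 0 then r - M/2 else 0 := by
        split_ifs with a1 a2 a2
        · have h5 : (∑ x ∈ range n', (x+1)) * 2 = n'*(n'+1) := by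
            have := Finset.sum_range_id_mul_two (n'+1)
            rw [Finset.sum_range_succ'] at this
            simp only [Nat.add_zero, Nat.add_sub_cancel] at this
            rw [this]; ring
          omega
        · omega
        · omega
        · simp
      rw [e2, e3, e4]
      unfold mpbTgt
      have : M / 2 ≤ r := by omega
      clear e1 e2 e3 e4 ih h key
      split_ifs <;> omega
  · -- subtract
    have hβn : β ≤ n := by
      by_contra hc
      have : M * β ≥ (2*n+1) * (n+1) := Nat.mul_le_mul (by omega) (by omega)
      nlinarith
    obtain ⟨n', hn'⟩ : ∃ n', n = n' + β := ⟨n-β, by omega⟩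
    obtain ⟨M', hM'⟩ : ∃ M', M + β = M' + 2*n+1 := ⟨M+β-2*n-1, by omega⟩
    have hMe : M = M' + (2*n'+β+1) := by omega
    have key : n'*(n'+1) = M'*β+2*r := by
      have : (n'+β)*(n'+β+1) = (M' + (2*n'+β+1))*β+2*r := by rw [← hMe, ← hn']; exact h
      nlinarith
    obtain ⟨f, hf⟩ := ih n' (by omega) M' β r key (by intro; have := hpar (by assumption); omega) (by
      by_contra hc
      push Not at hc
      obtain ⟨h1, h2⟩ := hc
      have hlt : M' + 1 ≤ n' := by omega
      have hM'β : β + M' ≥ 0 := by omega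
      have hM'ge : β ≤ M' := by omega
      rcases eq_or_lt_of_le hlt with he | he
      · have h3 : r < n' := by omega
        have hb : n' = M'+1 := by omega
        subst hb
        nlinarith
      · nlinarith)
    refine ⟨fun x => if x ≤ n' then f x else min (x - n') (β - (x - n' - 1)), fun i => ?_⟩
    have hsp := mpb_split_sum n' β i f (fun x => min (x - n') (β - (x - n' - 1)))
    rw [hn']
    rw [hsp, hf]
    have e1 : ∀ u ∈ range β, (if min (n'+u+1 - n') (β - (n'+u+1 - n' - 1)) = i then n'+u+1 else 0)
        = (if min (u+1) (β-u) = i then n'+u+1 else 0) := by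
      intro u hu
      rw [show n'+u+1-n' = u+1 by omega, show u+1-1 = u by omega]
    rw [Finset.sum_congr rfl e1, mpb_fold_sum]
    unfold mpbTgt
    clear e1 hf ih h key
    split_ifs <;> omega


/-- slot matrices of a chain group -/
def mpbSlot (K : Type) [Field K] (g : ℕ) : Fin g ⊕ Fin 2 → Matrix (Fin (g+1)) (Fin 2) K
  | Sum.inl m => fun i k => if k = 0 then (if i = m.castSucc then 1 else 0)
      else (if i = m.succ then 1 else 0)
  | Sum.inr t => fun i k => if k = t then 0 else (if i = 0 then 1 else 0)

/-- lengths of slots -/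
def mpbLen (b g c0 c1 : ℕ) (l : Fin g → ℕ) : Fin g ⊕ Fin 2 → ℕ
  | Sum.inl m => b + l m
  | Sum.inr t => if t = 0 then c0 else c1

/-- rank one matrix -/
def mpbE {K : Type} [Field K] {g b : ℕ} (i : Fin (g+1)) (v : Fin b → K) :
    Matrix (Fin (g+1)) (Fin b) K := fun i' q => if i' = i then v q else 0

lemma mpbSlot_inl {K : Type} [Field K] {g b : ℕ} (m : Fin g) (B : Matrix (Fin 2) (Fin b) K) :
    mpbSlot K g (Sum.inl m) * B = mpbE m.castSucc (B 0) + mpbE m.succ (B 1) := by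
  ext i q
  rw [Matrix.mul_apply, Fin.sum_univ_two]
  simp [mpbSlot, mpbE]

lemma mpbSlot_inr0 {K : Type} [Field K] {g b : ℕ} (B : Matrix (Fin 2) (Fin b) K) :
    mpbSlot K g (Sum.inr 0) * B = mpbE 0 (B 1) := by
  ext i q
  rw [Matrix.mul_apply, Fin.sum_univ_two]
  simp [mpbSlot, mpbE]

lemma mpbSlot_inr1 {K : Type} [Field K] {g b : ℕ} (B : Matrix (Fin 2) (Fin b) K) :
    mpbSlot K g (Sum.inr 1) * B = mpbE 0 (B 0) := by
  ext i q
  rw [Matrix.mul_apply, Fin.sum_univ_two]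
  simp [mpbSlot, mpbE]

lemma mpbE_zero {K : Type} [Field K] {g b : ℕ} (i : Fin (g+1)) :
    mpbE i (0 : Fin b → K) = 0 := by
  ext i' q; simp [mpbE]

theorem mpb_chain (K : Type) [Field K] (b g c0 c1 : ℕ) (l : Fin g → ℕ) (hl : Antitone l)
    (hc : c1 ≤ c0) (hsum : c0 + c1 + ∑ m, l m = b) :
    ∃ B : ℕ → Matrix (Fin 2) (Fin b) K, ∀ S : Submodule K (Matrix (Fin (g+1)) (Fin b) K),
      (∀ s j, j < mpbLen b g c0 c1 l s → mpbSlot K g s * B j ∈ S) → S = ⊤ := by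
  classical
  -- the index set, with the first `c0` coordinates in place
  obtain ⟨τ, hτ⟩ : ∃ τ : (Fin c0 ⊕ (Fin c1 ⊕ Σ m, Fin (l m))) ≃ Fin b,
      ∀ j : Fin c0, (τ (Sum.inl j) : ℕ) = j := by
    have hcard : Fintype.card (Fin c1 ⊕ Σ m, Fin (l m)) = c1 + ∑ m, l m := by simp
    have e1 := Fintype.equivFinOfCardEq hcard
    refine ⟨(Equiv.sumCongr (Equiv.refl _) e1).trans
      (finSumFinEquiv.trans (finCongr (by omega))), fun j => ?_⟩
    simp
  let e : (Fin c0 ⊕ (Fin c1 ⊕ Σ m, Fin (l m))) → Fin b → K := fun x => Pi.single (τ x) 1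
  let D : (Fin c0 ⊕ (Fin c1 ⊕ Σ m, Fin (l m))) → Fin b → K
    | Sum.inl j => if hj : (j:ℕ) < c1 then e (Sum.inr (Sum.inl ⟨j, hj⟩)) else 0
    | Sum.inr (Sum.inl _) => 0
    | Sum.inr (Sum.inr ⟨m, j⟩) => if hm : (m:ℕ)+1 < g then
        (if hj : (j:ℕ) < l ⟨m+1, hm⟩ then e (Sum.inr (Sum.inr ⟨⟨m+1, hm⟩, ⟨j, hj⟩⟩)) else 0) else 0
  let y : ℕ → Fin b → K := fun j => if hg : 0 < g then
    (if hj : j < l ⟨0, hg⟩ then e (Sum.inr (Sum.inr ⟨⟨0, hg⟩, ⟨j, hj⟩⟩)) else 0) else 0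
  let B : ℕ → Matrix (Fin 2) (Fin b) K := fun j =>
    if hj : j < b then Matrix.of ![D (τ.symm ⟨j, hj⟩), Pi.single ⟨j, hj⟩ 1]
    else Matrix.of ![y (j - b), 0]
  have hB1 : ∀ x, B (τ x) 1 = e x := by
    intro x
    simp only [B]
    rw [dif_pos (τ x).2]
    rfl
  have hB0 : ∀ x, B (τ x) 0 = D x := by
    intro x
    simp only [B]
    rw [dif_pos (τ x).2]
    simp
    rfl
  have hBy0 : ∀ j, B (b + j) 0 = y j := by
    intro j
    simp only [B]
    rw [dif_neg (by omega)]
    simp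
    rfl
  have hBy1 : ∀ j, B (b + j) 1 = 0 := by
    intro j
    simp only [B]
    rw [dif_neg (by omega)]
    simp
    rfl
  refine ⟨B, fun S hS => ?_⟩
  have h1 : ∀ j : Fin c0, mpbE 0 (e (Sum.inl j)) ∈ S := by
    intro j
    have := hS (Sum.inr 0) (τ (Sum.inl j)) (by rw [hτ]; simp [mpbLen])
    rwa [mpbSlot_inr0, hB1] at this
  have h2 : ∀ j : Fin c1, mpbE 0 (e (Sum.inr (Sum.inl j))) ∈ S := by
    intro j
    have hj : (j:ℕ) < c0 := by omega
    have := hS (Sum.inr 1) (τ (Sum.inl ⟨j, hj⟩)) (by rw [hτ]; simp [mpbLen])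
    rw [mpbSlot_inr1, hB0] at this
    simpa [D] using this
  have h3 : ∀ (m : Fin g) x, mpbE m.castSucc (D x) + mpbE m.succ (e x) ∈ S := by
    intro m x
    have := hS (Sum.inl m) (τ x) (by simp only [mpbLen]; omega)
    rwa [mpbSlot_inl, hB0, hB1] at this
  have h4 : ∀ (m : Fin g) (j : ℕ), j < l m → mpbE m.castSucc (y j) ∈ S := by
    intro m j hj
    have := hS (Sum.inl m) (b + j) (by simp only [mpbLen]; omega)
    rwa [mpbSlot_inl, hBy0, hBy1, mpbE_zero, add_zero] at this
  -- descending along the chain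
  have h5 : ∀ (t : ℕ) (k : ℕ) (m : Fin g) (hm : (m:ℕ) = t + k) (j : ℕ) (hj : j < l m),
      ∀ ht : t < g, ∃ hjt : j < l ⟨t, ht⟩,
      mpbE (⟨k, by omega⟩ : Fin (g+1)) (e (Sum.inr (Sum.inr ⟨⟨t, ht⟩, ⟨j, hjt⟩⟩))) ∈ S := by
    intro t
    induction t with
    | zero =>
      intro k m hm j hj ht
      have hjt : j < l ⟨0, ht⟩ := lt_of_lt_of_le hj (hl (by simp [Fin.le_def]))
      refine ⟨hjt, ?_⟩
      have := h4 m j hj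
      simp only [y] at this
      rw [dif_pos ht, dif_pos hjt] at this
      convert this using 2
      ext; simp; omega
    | succ t ih =>
      intro k m hm j hj ht
      have hjt : j < l ⟨t+1, ht⟩ := lt_of_lt_of_le hj (hl (by simp [Fin.le_def]; omega))
      refine ⟨hjt, ?_⟩
      obtain ⟨hj', h6⟩ := ih (k+1) m (by omega) j hj (by omega)
      have h7 := h3 ⟨k, by omega⟩ (Sum.inr (Sum.inr ⟨⟨t, by omega⟩, ⟨j, hj'⟩⟩))
      have h8 := S.sub_mem h7 h6
      simp only [D] at h8
      rw [dif_pos ht, dif_pos hjt] at h8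
      simpa using h8
  have h6 : ∀ x, mpbE 0 (e x) ∈ S := by
    rintro (j | j | ⟨m, j⟩)
    · exact h1 j
    · exact h2 j
    · obtain ⟨_, h7⟩ := h5 m 0 m rfl j j.2 m.2
      exact h7
  have h7 : ∀ (k : ℕ) (hk : k < g+1) (x), mpbE (⟨k, hk⟩ : Fin (g+1)) (e x) ∈ S := by
    intro k
    induction k with
    | zero => intro hk x; exact h6 x
    | succ k ih =>
      intro hk x
      have h8 := h3 ⟨k, by omega⟩ x
      have h9 : mpbE (⟨k, by omega⟩ : Fin (g+1)) (D x) ∈ S := by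
        rcases x with (j | j | ⟨m, j⟩)
        · simp only [D]; split_ifs
          · exact ih _ _
          · rw [mpbE_zero]; exact S.zero_mem
        · simp only [D]; rw [mpbE_zero]; exact S.zero_mem
        · simp only [D]; split_ifs
          · exact ih _ _
          · rw [mpbE_zero]; exact S.zero_mem
          · rw [mpbE_zero]; exact S.zero_mem
      have := S.sub_mem h8 h9
      simpa using this
  rw [eq_top_iff]
  intro X _
  rw [Matrix.matrix_eq_sum_single X]
  refine S.sum_mem fun i _ => S.sum_mem fun q _ => ?_
  have h8 := S.smul_mem (X i q) (h7 i i.2 (τ.symm q))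
  convert h8 using 1
  ext i' q'
  simp only [Matrix.single, Matrix.of_apply, Matrix.smul_apply, mpbE, e, Equiv.apply_symm_apply,
    Fin.eta, Pi.single_apply, smul_eq_mul]
  by_cases h1 : i' = i <;> by_cases h2 : q' = q <;> simp [h1, h2, eq_comm] <;> grind

/-- generic matrices `B_j` as a point of affine space -/
def mpbB {K : Type} {b : ℕ} (x : ℕ × Fin 2 × Fin b → K) (j : ℕ) : Matrix (Fin 2) (Fin b) K :=
  fun k q => x (j, k, q)

theorem mpb_poly (K : Type) [Field K] (b g c0 c1 : ℕ) (l : Fin g → ℕ) (hl : Antitone l)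
    (hc : c1 ≤ c0) (hsum : c0 + c1 + ∑ m, l m = b) :
    ∃ P : MvPolynomial (ℕ × Fin 2 × Fin b) K, P ≠ 0 ∧ ∀ x, MvPolynomial.eval x P ≠ 0 →
      ∀ S : Submodule K (Matrix (Fin (g+1)) (Fin b) K),
      (∀ s j, j < mpbLen b g c0 c1 l s → mpbSlot K g s * mpbB x j ∈ S) → S = ⊤ := by
  classical
  have hcard : Fintype.card (Σ s, Fin (mpbLen b g c0 c1 l s))
      = Fintype.card (Fin (g+1) × Fin b) := by
    rw [Fintype.card_sigma, Fintype.sum_sum_type]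
    simp only [Fintype.card_fin, Fintype.card_prod, Fin.sum_univ_two]
    simp [mpbLen, Finset.sum_add_distrib]
    nlinarith
  let e := Fintype.equivOfCardEq hcard
  let N : Matrix (Σ s, Fin (mpbLen b g c0 c1 l s)) (Σ s, Fin (mpbLen b g c0 c1 l s))
      (MvPolynomial (ℕ × Fin 2 × Fin b) K) := fun u v =>
    ∑ k, MvPolynomial.C (mpbSlot K g u.1 (e v).1 k) * MvPolynomial.X ((u.2 : ℕ), k, (e v).2)
  have hN : ∀ x, MvPolynomial.eval x N.det
      = (Matrix.of fun u v => (mpbSlot K g u.1 * mpbB x u.2) (e v).1 (e v).2 :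
        Matrix (Σ s, Fin (mpbLen b g c0 c1 l s)) (Σ s, Fin (mpbLen b g c0 c1 l s)) K).det := by
    intro x
    rw [RingHom.map_det]
    congr 1
    ext u v
    rw [RingHom.mapMatrix_apply, Matrix.map_apply, Matrix.of_apply, Matrix.mul_apply]
    simp [N, mpbB]
  refine ⟨N.det, ?_, ?_⟩
  · obtain ⟨B, hB⟩ := mpb_chain K b g c0 c1 l hl hc hsum
    intro h0
    have h1 := hN (fun z => B z.1 z.2.1 z.2.2)
    rw [h0, map_zero] at h1
    obtain ⟨v, hv, hv0⟩ := Matrix.exists_mulVec_eq_zero_iff.mpr h1.symm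
    let φ : Matrix (Fin (g+1)) (Fin b) K →ₗ[K] K :=
      { toFun := fun X => ∑ u, X (e u).1 (e u).2 * v u
        map_add' := by intro X Y; simp [add_mul, Finset.sum_add_distrib]
        map_smul' := by intro c X; simp [mul_assoc, Finset.mul_sum] }
    have h2 := hB (LinearMap.ker φ) (by
      intro s j hj
      rw [LinearMap.mem_ker]
      exact congrFun hv0 ⟨s, ⟨j, hj⟩⟩)
    apply hv
    ext u
    have h3 : Matrix.single (e u).1 (e u).2 (1:K) ∈ LinearMap.ker φ := by rw [h2]; trivial
    rw [LinearMap.mem_ker] at h3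
    have h4 : φ (Matrix.single (e u).1 (e u).2 (1:K)) = v u := by
      change ∑ w, Matrix.single (e u).1 (e u).2 (1:K) (e w).1 (e w).2 * v w = v u
      rw [Finset.sum_eq_single u]
      · simp
      · intro w _ hw
        rw [Matrix.single_apply_of_ne, zero_mul]
        rintro ⟨p, q⟩
        exact hw (e.injective (Prod.ext p q)).symm
      · simp
    rw [h3] at h4
    exact h4.symm
  · intro x hx S hS
    rw [hN] at hx
    set M := (Matrix.of fun u v => (mpbSlot K g u.1 * mpbB x u.2) (e v).1 (e v).2 :
        Matrix (Σ s, Fin (mpbLen b g c0 c1 l s)) (Σ s, Fin (mpbLen b g c0 c1 l s)) K) with hM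
    have hinv : M⁻¹ * M = 1 := Matrix.nonsing_inv_mul _ (isUnit_iff_ne_zero.mpr hx)
    have h1 : ∀ u, Matrix.single (e u).1 (e u).2 (1:K)
        = ∑ w, M⁻¹ u w • (mpbSlot K g w.1 * mpbB x w.2) := by
      intro u
      ext i q
      obtain ⟨v, hv⟩ := e.surjective (i, q)
      have h2 := congrFun (congrFun hinv u) v
      rw [Matrix.mul_apply] at h2
      simp only [Matrix.sum_apply, Matrix.smul_apply, smul_eq_mul]
      have h3 : ∀ w, M w v = (mpbSlot K g w.1 * mpbB x w.2) i q := by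
        intro w; simp [hM, hv]
      simp only [h3] at h2
      rw [h2, Matrix.one_apply, Matrix.single_apply]
      by_cases huv : u = v
      · subst huv; simp [hv]
      · rw [if_neg huv, if_neg]
        rintro ⟨p, q'⟩
        exact huv (e.injective (by rw [hv]; exact Prod.ext p q'))
    rw [eq_top_iff]
    intro X _
    rw [Matrix.matrix_eq_sum_single X]
    refine S.sum_mem fun i _ => S.sum_mem fun q _ => ?_
    have h2 : Matrix.single i q (1:K) ∈ S := by
      have := h1 (e.symm (i, q))
      simp only [Equiv.apply_symm_apply] at this
      rw [this]
      exact S.sum_mem fun w _ => S.smul_mem _ (hS _ _ w.2.2)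
    have h3 := S.smul_mem (X i q) h2
    rwa [Matrix.smul_single, smul_eq_mul, mul_one] at h3

theorem mpb_common (K : Type) [Field K] [CharZero K] (b : ℕ) (Γ : Type) [Fintype Γ]
    (g c0 c1 : Γ → ℕ) (l : ∀ γ, Fin (g γ) → ℕ) (hl : ∀ γ, Antitone (l γ))
    (hc : ∀ γ, c1 γ ≤ c0 γ) (hsum : ∀ γ, c0 γ + c1 γ + ∑ m, l γ m = b) :
    ∃ B : ℕ → Matrix (Fin 2) (Fin b) K, ∀ γ,
      ∀ S : Submodule K (Matrix (Fin (g γ+1)) (Fin b) K),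
      (∀ s j, j < mpbLen b (g γ) (c0 γ) (c1 γ) (l γ) s → mpbSlot K (g γ) s * B j ∈ S) → S = ⊤ := by
  choose P hP hP' using fun γ => mpb_poly K b (g γ) (c0 γ) (c1 γ) (l γ) (hl γ) (hc γ) (hsum γ)
  have hprod : ∏ γ, P γ ≠ 0 := Finset.prod_ne_zero_iff.mpr fun γ _ => hP γ
  have : ∃ x, MvPolynomial.eval x (∏ γ, P γ) ≠ 0 := by
    by_contra hcon
    push Not at hcon
    have : Infinite K := CharZero.infinite K
    exact hprod (MvPolynomial.funext fun x => by rw [hcon, map_zero])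
  obtain ⟨x, hx⟩ := this
  rw [map_prod] at hx
  exact ⟨mpbB x, fun γ => hP' γ x (Finset.prod_ne_zero_iff.mp hx γ (Finset.mem_univ _))⟩

lemma mpb_sorted {ρ : Type} (X : Finset ρ) (L : ρ → ℕ) :
    ∃ σ : Fin X.card ≃ X, Antitone fun m => L (σ m) := by
  let e := X.equivFin.symm
  let w : Fin X.card → ℕᵒᵈ := fun m => OrderDual.toDual (L (e m))
  refine ⟨(Tuple.sort w).trans e, ?_⟩
  have := Tuple.monotone_sort w
  intro m m' hm
  exact this hm

theorem mpb_assemble (K : Type) [Field K] [CharZero K] (a b : ℕ) (Γ ρ : Type) [Fintype Γ]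
    [Fintype ρ] [DecidableEq Γ] (L : ρ → ℕ) (lab : ρ → Γ) (kind : ρ → Option (Fin 2))
    (c0 c1 : Γ → ℕ) (hexc : ∀ r, kind r = none → b ≤ L r)
    (h0 : ∀ γ, 0 < c0 γ → ∃ r, lab r = γ ∧ kind r = some 0 ∧ L r = c0 γ)
    (h1 : ∀ γ, 0 < c1 γ → ∃ r, lab r = γ ∧ kind r = some 1 ∧ L r = c1 γ)
    (hc : ∀ γ, c1 γ ≤ c0 γ)
    (hsum : ∀ γ, c0 γ + c1 γ + ∑ r, (if lab r = γ ∧ kind r = none then L r - b else 0) = b)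
    (hcard : Fintype.card Γ + ∑ r, (if kind r = none then 1 else 0) = a) :
    ∃ (A : ρ → Matrix (Fin a) (Fin 2) K) (B : ℕ → Matrix (Fin 2) (Fin b) K),
      ∀ S : Submodule K (Matrix (Fin a) (Fin b) K),
        (∀ r j, j < L r → A r * B j ∈ S) → S = ⊤ := by
  classical
  let X : Γ → Finset ρ := fun γ => Finset.univ.filter fun r => lab r = γ ∧ kind r = none
  choose σ hσ using fun γ => mpb_sorted (X γ) (fun r => L r - b)
  obtain ⟨B, hB⟩ := mpb_common K b Γ (fun γ => (X γ).card) c0 c1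
    (fun γ m => L (σ γ m) - b) hσ hc (by
      intro γ
      refine Eq.trans ?_ (hsum γ)
      congr 1
      rw [Equiv.sum_comp (σ γ) (fun r : X γ => L r - b), Finset.sum_coe_sort (X γ) (fun r => L r - b),
        Finset.sum_filter])
  have hcι : Fintype.card (Σ γ, Fin ((X γ).card + 1)) = Fintype.card (Fin a) := by
    rw [Fintype.card_fin, Fintype.card_sigma, ← hcard]
    simp only [Fintype.card_fin, Finset.sum_add_distrib, Finset.sum_const, smul_eq_mul, mul_one,
      Finset.card_univ]
    rw [add_comm]
    congr 1
    simp only [X, Finset.card_filter]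
    rw [Finset.sum_comm]
    refine Finset.sum_congr rfl fun r _ => ?_
    by_cases hk : kind r = none <;> simp [hk]
  let e := Fintype.equivOfCardEq hcι
  let E : ∀ γ, Matrix (Fin a) (Fin ((X γ).card + 1)) K :=
    fun γ i i' => if i = e ⟨γ, i'⟩ then 1 else 0
  let role : ∀ r, Fin (X (lab r)).card ⊕ Fin 2 := fun r =>
    if hk : kind r = none then
      Sum.inl ((σ (lab r)).symm ⟨r, by simp [X, hk]⟩) else Sum.inr ((kind r).getD 0)
  refine ⟨fun r => E (lab r) * mpbSlot K _ (role r), B, fun S hS => ?_⟩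
  have key : ∀ γ (Y : Matrix (Fin ((X γ).card + 1)) (Fin b) K), E γ * Y ∈ S := by
    intro γ
    let φ : Matrix (Fin ((X γ).card + 1)) (Fin b) K →ₗ[K] Matrix (Fin a) (Fin b) K :=
      { toFun := fun Y => E γ * Y
        map_add' := fun Y Z => Matrix.mul_add _ _ _
        map_smul' := fun c Y => Matrix.mul_smul _ _ _ }
    have htop : S.comap φ = ⊤ := by
      apply hB γ
      intro s j hj
      change E γ * (mpbSlot K _ s * B j) ∈ S
      rw [← Matrix.mul_assoc]
      rcases s with m | t
      · obtain ⟨r, hr⟩ : ∃ r, r = σ γ m := ⟨_, rfl⟩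
        have hr2 := r.2
        simp only [X, Finset.mem_filter, Finset.mem_univ, true_and] at hr2
        obtain ⟨hr3, hr4⟩ := hr2
        have h5 := hS r j (by
          simp only [mpbLen] at hj
          have := hexc _ hr4
          rw [← hr] at hj
          omega)
        have h6 : role r = Sum.inl ((σ (lab r)).symm ⟨r, by simp [X, hr4]⟩) := by
          simp only [role]; rw [dif_pos hr4]
        simp only [h6] at h5
        obtain ⟨r, hrX⟩ := r
        simp only at hr3
        subst hr3
        have h7 : (σ (lab r)).symm ⟨r, hrX⟩ = m := by rw [hr]; simp
        rw [h7] at h5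
        exact h5
      · have hex : ∃ r, lab r = γ ∧ kind r = some t ∧ j < L r := by
          simp only [mpbLen] at hj
          fin_cases t
          · simp at hj
            obtain ⟨r, p1, p2, p3⟩ := h0 γ (by omega)
            exact ⟨r, p1, p2, by omega⟩
          · simp at hj
            obtain ⟨r, p1, p2, p3⟩ := h1 γ (by omega)
            exact ⟨r, p1, p2, by omega⟩
        obtain ⟨r, p1, p2, p3⟩ := hex
        have h5 := hS r j p3
        have h6 : role r = Sum.inr t := by
          simp only [role]; rw [dif_neg (by rw [p2]; simp), p2]; rfl
        simp only [h6] at h5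
        subst p1
        exact h5
    intro Y
    have : Y ∈ S.comap φ := by rw [htop]; trivial
    exact this
  rw [eq_top_iff]
  intro Z _
  rw [Matrix.matrix_eq_sum_single Z]
  refine S.sum_mem fun i _ => S.sum_mem fun q _ => ?_
  have h2 := key (e.symm i).1 (Matrix.single (e.symm i).2 q (Z i q))
  convert h2 using 1
  ext i' q'
  rw [Matrix.mul_apply, Finset.sum_eq_single (e.symm i).2]
  · simp only [E, Sigma.eta, Equiv.apply_symm_apply, Matrix.single_apply]
    grind
  · intro w _ hw
    rw [Matrix.single_apply_of_ne, mul_zero]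
    rintro ⟨p, _⟩
    exact hw p.symm
  · simp

theorem mpb_groups (K : Type) [Field K] [CharZero K] (a b n i0 p E : ℕ) (f : ℕ → ℕ) (hlab : ℕ)
    (kA : Option (Fin 2)) (c0 c1 : ℕ → ℕ) (hb : 1 ≤ b) (hn : n = b + p) (hE : 0 < E)
    (hf : ∀ x, x < p → f (x+1) < E) (hh : b % 2 = 0 → hlab < E) (hkA : kA = none → b ≤ i0)
    (hc0 : ∀ e, e < E → 0 < c0 e →
      (b % 2 = 0 ∧ e = hlab ∧ c0 e = b/2) ∨ (e = 0 ∧ kA = some 0 ∧ c0 e = i0))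
    (hc1 : ∀ e, e < E → 0 < c1 e → e = 0 ∧ kA = some 1 ∧ c1 e = i0)
    (hc : ∀ e, e < E → c1 e ≤ c0 e)
    (hsum : ∀ e, e < E → c0 e + c1 e + ((if e = 0 ∧ kA = none then i0 - b else 0) +
      ∑ x ∈ range p, (if f (x+1) = e then x+1 else 0)) = b)
    (hcard : (b+1)/2 + E + ((if kA = none then 1 else 0) + p) = a) :
    ∃ (A : Option (Fin n) → Matrix (Fin a) (Fin 2) K) (B : ℕ → Matrix (Fin 2) (Fin b) K),
      ∀ S : Submodule K (Matrix (Fin a) (Fin b) K),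
        (∀ r j, j < (match r with | none => i0 | some i => (i:ℕ)+1) → A r * B j ∈ S) → S = ⊤ := by
  classical
  obtain ⟨labN, hlabN⟩ : ∃ labN : ℕ → ℕ, ∀ x, labN x =
      if b < x then (b+1)/2 + f (x-b) else if b < 2*x then b-x else if 2*x < b then x
        else (b+1)/2 + hlab := ⟨_, fun _ => rfl⟩
  obtain ⟨kN, hkN⟩ : ∃ kN : ℕ → Option (Fin 2), ∀ x, kN x =
      if b < x then none else if b ≤ 2*x then some 0 else some 1 := ⟨_, fun _ => rfl⟩
  have hlt : ∀ x, x < n → labN (x+1) < (b+1)/2 + E := by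
    intro x hx
    rw [hlabN]
    split_ifs with q1 q2 q3
    · have := hf (x-b) (by omega)
      rw [show x-b+1 = x+1-b by omega] at this
      omega
    · omega
    · omega
    · have := hh (by omega); omega
  refine mpb_assemble K a b (Fin ((b+1)/2 + E)) (Option (Fin n)) _
    (fun r => match r with
      | none => ⟨(b+1)/2, by omega⟩
      | some i => ⟨labN (i+1), hlt i i.2⟩)
    (fun r => match r with
      | none => kA
      | some i => kN (i+1))
    (fun γ => if (γ:ℕ) < (b+1)/2 then b - γ else c0 (γ - (b+1)/2))
    (fun γ => if (γ:ℕ) < (b+1)/2 then γ else c1 (γ - (b+1)/2)) ?_ ?_ ?_ ?_ ?_ ?_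
  · rintro (_ | i) hk
    · exact hkA hk
    · simp only [hkN] at hk
      split_ifs at hk
      simp only
      omega
  · rintro ⟨v, hv⟩ hpos
    simp only at hpos ⊢
    by_cases hvP : v < (b+1)/2
    · rw [if_pos hvP]
      refine ⟨some ⟨b-v-1, by omega⟩, ?_, ?_, ?_⟩
      · simp only [Fin.mk.injEq, hlabN]
        split_ifs <;> omega
      · simp only [hkN]
        rw [if_neg (by omega), if_pos (by omega)]
      · simp only; omega
    · rw [if_neg hvP] at hpos ⊢
      rcases hc0 _ (by omega) hpos with ⟨q1, q2, q3⟩ | ⟨q1, q2, q3⟩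
      · refine ⟨some ⟨b/2-1, by omega⟩, ?_, ?_, ?_⟩
        · simp only [Fin.mk.injEq, hlabN]
          split_ifs <;> omega
        · simp only [hkN]
          rw [if_neg (by omega), if_pos (by omega)]
        · simp only; omega
      · refine ⟨none, ?_, q2, q3.symm⟩
        simp only [Fin.mk.injEq]; omega
  · rintro ⟨v, hv⟩ hpos
    simp only at hpos ⊢
    by_cases hvP : v < (b+1)/2
    · rw [if_pos hvP] at hpos ⊢
      refine ⟨some ⟨v-1, by omega⟩, ?_, ?_, ?_⟩
      · simp only [Fin.mk.injEq, hlabN]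
        split_ifs <;> omega
      · simp only [hkN]
        rw [if_neg (by omega), if_neg (by omega)]
      · simp only; omega
    · rw [if_neg hvP] at hpos ⊢
      obtain ⟨q1, q2, q3⟩ := hc1 _ (by omega) hpos
      refine ⟨none, ?_, q2, q3.symm⟩
      simp only [Fin.mk.injEq]; omega
  · rintro ⟨v, hv⟩
    simp only
    split_ifs
    · omega
    · exact hc _ (by omega)
  · rintro ⟨v, hv⟩
    have hk : ∀ x, kN x = none ↔ b < x := by
      intro x; rw [hkN]; split_ifs <;> simp [*]
    rw [Fintype.sum_option]
    simp only [Fin.mk.injEq, hk]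
    rw [Fin.sum_univ_eq_sum_range
      (fun i => if labN (i+1) = v ∧ b < i+1 then i+1-b else 0) n, hn, Finset.sum_range_add,
      Finset.sum_eq_zero (s := range b) (by
        intro x hx
        rw [Finset.mem_range] at hx
        rw [if_neg (by omega)]), zero_add]
    by_cases hvP : v < (b+1)/2
    · rw [if_pos hvP, if_pos hvP, if_neg (by omega), zero_add, Finset.sum_eq_zero, add_zero]
      · omega
      · intro x _
        rw [if_neg]
        rw [hlabN]
        rintro ⟨q1, q2⟩
        rw [if_pos q2] at q1
        omega
    · rw [if_neg hvP, if_neg hvP]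
      refine Eq.trans ?_ (hsum (v - (b+1)/2) (by omega))
      congr 2
      · congr 1
        apply propext
        refine and_congr_left fun _ => ?_
        omega
      · refine Finset.sum_congr rfl fun x _ => ?_
        have hl2 : labN (b+x+1) = (b+1)/2 + f (x+1) := by
          rw [hlabN, if_pos (by omega), show b+x+1-b = x+1 by omega]
        rw [hl2]
        split_ifs <;> omega
  · have hk : ∀ x, kN x = none ↔ b < x := by
      intro x; rw [hkN]; split_ifs <;> simp [*]
    rw [Fintype.sum_option]
    simp only [hk]
    rw [Fin.sum_univ_eq_sum_range
      (fun i => if b < i+1 then 1 else 0) n, hn, Finset.sum_range_add,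
      Finset.sum_eq_zero (s := range b) (by
        intro x hx
        rw [Finset.mem_range] at hx
        rw [if_neg (by omega)]), zero_add, Finset.sum_congr rfl (g := fun _ => 1) (by
        intro x _
        rw [if_pos (by omega)])]
    simpa using hcard

lemma mpb_label_bound (n M β r : ℕ) (f : ℕ → ℕ)
    (hf : ∀ i, ∑ x ∈ range n, (if f (x+1) = i then x+1 else 0) = mpbTgt M β r i) (x : ℕ)
    (hx : x < n) : 2 * f (x+1) ≤ β + 1 := by
  have h1 := Finset.single_le_sum (f := fun y => if f (y+1) = f (x+1) then y+1 else 0)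
    (fun _ _ => Nat.zero_le _) (Finset.mem_range.mpr hx)
  simp only [if_true] at h1
  rw [hf] at h1
  unfold mpbTgt at h1
  split_ifs at h1 <;> omega

lemma mpb_gauss (p : ℕ) : 2 * ∑ x ∈ range p, (x+1) = p*(p+1) := by
  induction p with
  | zero => simp
  | succ p ih => rw [Finset.sum_range_succ, mul_add, ih]; ring

theorem mpb_main (K : Type) [Field K] [CharZero K]
    (a b n i0 : ℕ) (hb : 1 ≤ b) (hab : a = b ∨ a = b + 1)
    (h : 2 * (a * b) = n * (n + 1) + 2 * i0) (hi : i0 ≤ n)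
    (hcond : a = b → i0 ≤ b) :
    ∃ (A : Option (Fin n) → Matrix (Fin a) (Fin 2) K) (B : ℕ → Matrix (Fin 2) (Fin b) K),
      ∀ S : Submodule K (Matrix (Fin a) (Fin b) K),
        (∀ r j, j < (match r with | none => i0 | some i => (i:ℕ)+1) → A r * B j ∈ S) → S = ⊤ := by
  have hbn : b ≤ n := by
    by_contra hcon
    obtain ⟨d, rfl⟩ : ∃ d, b = n + 1 + d := ⟨b-n-1, by omega⟩
    rcases hab with h1 | h1 <;> subst h1 <;> nlinarith
  obtain ⟨p, hp⟩ : ∃ p, n = b + p := ⟨n-b, by omega⟩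
  have hpb : p ≤ b ∧ 2*p ≤ b+1 := by
    constructor
    · by_contra hcon
      rcases hab with h1 | h1 <;> subst h1 <;> subst hp <;> nlinarith
    · by_contra hcon
      obtain ⟨d, hd⟩ : ∃ d, 2*p = b+2+d := ⟨2*p-b-2, by omega⟩
      rcases hab with h1 | h1 <;> subst h1 <;> subst hp <;> nlinarith
  obtain ⟨c, hcdef⟩ : ∃ c, c = if i0 ≤ b then i0 else i0 - b := ⟨_, rfl⟩
  obtain ⟨w, hw⟩ : ∃ w, 2*a = w + 2*p + b + 1 + (if i0 ≤ b then 0 else 2) ∧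
      p*(p+1) + 2*c = b*w := by
    by_cases hib : i0 ≤ b
    · rw [if_pos hib] at hcdef
      subst hcdef
      simp only [if_pos hib]
      have hle : 2*p + b + 1 ≤ 2*a := by
        by_contra hcon
        obtain ⟨d, hd⟩ : ∃ d, 2*p+b+1 = 2*a+1+d := ⟨2*p+b+1-2*a-1, by omega⟩
        subst hp
        have e1 : b * (2*p+b+1) = b*(2*a+1+d) := by rw [hd]
        nlinarith
      obtain ⟨w, hw⟩ : ∃ w, 2*a = w + 2*p + b + 1 := ⟨2*a-2*p-b-1, by omega⟩
      refine ⟨w, by omega, ?_⟩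
      subst hp
      have e1 : b * (2*a) = b*(w+2*p+b+1) := by rw [hw]
      nlinarith
    · rw [if_neg hib] at hcdef
      simp only [if_neg hib]
      have hi2 : i0 = b + c := by omega
      have hle : 2*p + b + 3 ≤ 2*a := by
        by_contra hcon
        obtain ⟨d, hd⟩ : ∃ d, 2*p+b+3 = 2*a+1+d := ⟨2*p+b+3-2*a-1, by omega⟩
        subst hp
        have e1 : b * (2*p+b+3) = b*(2*a+1+d) := by rw [hd]
        nlinarith
      obtain ⟨w, hw⟩ : ∃ w, 2*a = w + 2*p + b + 3 := ⟨2*a-2*p-b-3, by omega⟩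
      refine ⟨w, by omega, ?_⟩
      subst hp
      have e1 : b * (2*a) = b*(w+2*p+b+3) := by rw [hw]
      nlinarith
  obtain ⟨hw1, hw2⟩ := hw
  have hcb : c ≤ b := by
    split_ifs at hcdef <;> omega
  rcases w with _ | _ | β
  · -- trivial case
    have hc0 : c = 0 := by omega
    have hp0 : p = 0 := by nlinarith
    have hi0 : i0 = 0 := by split_ifs at hcdef <;> omega
    rw [if_pos (by omega)] at hw1
    have hb1 : b = 1 := by omega
    have ha1 : a = 1 := by omega
    have hn1 : n = 1 := by omega
    clear hpb hcdef
    subst hb1 ha1 hn1 hi0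
    refine mpb_assemble K 1 1 (Fin 1) (Option (Fin 1)) _ (fun _ => 0) (fun _ => some 0)
      (fun _ => 1) (fun _ => 0) ?_ ?_ ?_ ?_ ?_ ?_
    · intro r hr; simp at hr
    · intro γ _
      exact ⟨some 0, by ext; simp, rfl, rfl⟩
    · intro γ hγ; simp at hγ
    · intro γ; simp
    · intro γ; simp
    · simp
  · -- a single group
    have hg := mpb_gauss p
    refine mpb_groups K a b n i0 p 1 (fun _ => 0) 0 (if i0 ≤ b then some 1 else none)
      (fun _ => b/2) (fun _ => if i0 ≤ b then i0 else 0) hb hp (by omega) (by intros; omega)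
      (by intros; omega) ?_ ?_ ?_ ?_ ?_ ?_
    · intro hk
      split_ifs at hk
      omega
    · intro e he _
      left
      refine ⟨?_, by omega, rfl⟩
      split_ifs at hw1 <;> omega
    · intro e he hpos
      by_cases hib : i0 ≤ b
      · rw [if_pos hib, if_pos hib]; exact ⟨by omega, rfl, rfl⟩
      · rw [if_neg hib] at hpos; omega
    · intro e he
      split_ifs at hcdef ⊢ <;> omega
    · intro e he
      have he0 : e = 0 := by omega
      subst he0
      simp only [if_true, true_and]
      by_cases hib : i0 ≤ b
      · simp only [if_pos hib] at hcdef hw1 ⊢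
        rw [if_neg (by simp)]
        omega
      · simp only [if_neg hib] at hcdef hw1 ⊢
        rw [if_pos trivial]
        omega
    · by_cases hib : i0 ≤ b
      · simp only [if_pos hib] at hcdef hw1 ⊢
        rw [if_neg (by simp)]
        omega
      · simp only [if_neg hib] at hcdef hw1 ⊢
        rw [if_pos trivial]
        omega
  · have hpar : β % 2 = 1 ↔ b % 2 = 0 := by split_ifs at hw1 <;> omega
    obtain ⟨f, hf⟩ := mpb_partition p b β (b-c) (by
      obtain ⟨d, hd⟩ : ∃ d, b = c + d := ⟨b-c, by omega⟩
      have : b - c = d := by omega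
      rw [this]
      nlinarith) hpar.mp (Or.inl hpb.1)
    refine mpb_groups K a b n i0 p (1 + (β+1)/2) f (β/2+1) (if i0 ≤ b then some 0 else none)
      (fun e => if e = 0 then (if i0 ≤ b then i0 else 0) else if 2*e = β+1 then b/2 else 0)
      (fun _ => 0) hb hp (by omega) ?_ (by intros; omega) ?_ ?_ ?_ ?_ ?_ ?_
    · intro x hx
      have := mpb_label_bound p b β (b-c) f hf x hx
      omega
    · intro hk
      split_ifs at hk
      omega
    · intro e he hpos
      by_cases he0 : e = 0
      · simp only [if_pos he0] at hpos ⊢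
        by_cases hib : i0 ≤ b
        · simp only [if_pos hib] at hpos ⊢
          right; exact ⟨he0, trivial, trivial⟩
        · rw [if_neg hib] at hpos; omega
      · simp only [if_neg he0] at hpos ⊢
        split_ifs at hpos with q1
        · left
          rw [if_pos q1]
          refine ⟨by omega, by omega, rfl⟩
        · omega
    · intro e he hpos; simp at hpos
    · intro e he; exact Nat.zero_le _
    · intro e he
      rw [hf]
      unfold mpbTgt
      by_cases hib : i0 ≤ b
      · simp only [if_pos hib] at hcdef hw1 ⊢
        simp only [reduceCtorEq, and_false, if_false]
        split_ifs <;> omega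
      · simp only [if_neg hib] at hcdef hw1 ⊢
        simp only [and_true]
        split_ifs <;> omega
    · by_cases hib : i0 ≤ b
      · simp only [if_pos hib] at hcdef hw1 ⊢
        rw [if_neg (by simp)]
        omega
      · simp only [if_neg hib] at hcdef hw1 ⊢
        rw [if_pos trivial]
        omega

theorem exists_matrix_products_basis (K : Type) [Field K] [CharZero K]
    (a b n i₀ : ℕ) (hb : 1 ≤ b) (hab : a = b ∨ a = b + 1)
    (h : a * b = n * (n + 1) / 2 + i₀) (hi : i₀ ≤ n)
    (hcond : a = b → i₀ ≤ b) :
    ∃ (A : Fin n → Matrix (Fin a) (Fin 2) K) (A' : Matrix (Fin a) (Fin 2) K)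
      (B : Fin n → Matrix (Fin 2) (Fin b) K),
      LinearIndependent K
        (Sum.elim
          (fun q : {q : Fin n × Fin n // q.2 ≤ q.1} => A q.1.1 * B q.1.2)
          (fun j : Fin i₀ => A' * B (Fin.castLE hi j))) ∧
      Submodule.span K
        (Set.range
          (Sum.elim
            (fun q : {q : Fin n × Fin n // q.2 ≤ q.1} => A q.1.1 * B q.1.2)
            (fun j : Fin i₀ => A' * B (Fin.castLE hi j)))) = ⊤ := by
  have hev : 2 * (n * (n+1) / 2) = n * (n+1) :=
    Nat.mul_div_cancel' (Nat.even_mul_succ_self n).two_dvd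
  obtain ⟨A, B, hAB⟩ := mpb_main K a b n i₀ hb hab (by rw [h, mul_add, hev]) hi hcond
  have htop := hAB (Submodule.span K
        (Set.range
          (Sum.elim
            (fun q : {q : Fin n × Fin n // q.2 ≤ q.1} => A (some q.1.1) * B q.1.2)
            (fun j : Fin i₀ => A none * B (Fin.castLE hi j))))) (by
    rintro (_ | i) j hj
    · exact Submodule.subset_span ⟨Sum.inr ⟨j, hj⟩, rfl⟩
    · simp only at hj
      exact Submodule.subset_span ⟨Sum.inl ⟨(i, ⟨j, by omega⟩), by
        rw [Fin.le_def]; simp only; omega⟩, rfl⟩)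
  refine ⟨fun i => A (some i), A none, fun j => B j, ?_, htop⟩
  apply linearIndependent_of_top_le_span_of_card_eq_finrank
  · exact htop.ge
  · rw [Module.finrank_matrix, Fintype.card_sum, Fintype.card_fin, Fintype.card_fin,
      Fintype.card_fin, Module.finrank_self, mul_one, h]
    congr 1
    rw [Fintype.card_subtype, Finset.card_filter, Fintype.sum_prod_type]
    have h1 : ∀ x : Fin n, ∑ y : Fin n, (if y ≤ x then 1 else 0) = (x:ℕ) + 1 := by
      intro x
      rw [← Finset.card_filter]
      have : (Finset.univ.filter fun y : Fin n => y ≤ x) = Finset.Iic x := by ext; simp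
      rw [this, Fin.card_Iic]
    simp only [h1]
    rw [Fin.sum_univ_eq_sum_range (fun x => x+1) n]
    have := mpb_gauss n
    omega
end

section
/- Let r ≥ 2 and let a ≥ b be the integer square roots of r(r-1)/2 (i.e., a = ⌈√(r(r-1)/2)⌉, b = a-1 if a(a-1) ≥ r(r-1)/2 else b = a). Then there exist matrices X₁,…,X_r ∈ M_{a×2}(𝕂) and Y₁,…,Y_r ∈ M_{2×b}(𝕂) such that the r(r-1)/2 matrices Z_{ij} = X_i Y_j - X_j Y_i, for 1 ≤ j < i ≤ r, are linearly independent in M_{a×b}(𝕂). -/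
open Matrix

/-- Wedge problem: two pairs of families detecting every alternating matrix. -/
def WedgeP (K : Type) [Field K] (R A B : Type) [Fintype R] : Prop :=
  ∃ (A1 A2 : A → R → K) (B1 B2 : B → R → K), ∀ w : Matrix R R K, (∀ i j, w i j = - w j i) →
    (∀ a b, A1 a ⬝ᵥ (w *ᵥ B1 b) + A2 a ⬝ᵥ (w *ᵥ B2 b) = 0) → w = 0

/-- Independence of the minors of two pencils, in dual form. -/
def WedgeQ (K : Type) [Field K] (M S T : Type) [Fintype S] [Fintype T] : Prop :=
  ∃ (FS GS : M → S → K) (FT GT : M → T → K), ∀ (w : Matrix S S K) (u : Matrix T T K),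
    (∀ i j, w i j = - w j i) → (∀ i j, u i j = - u j i) →
    (∀ i j, FS i ⬝ᵥ (w *ᵥ GS j) - GS i ⬝ᵥ (w *ᵥ FS j)
      + (FT i ⬝ᵥ (u *ᵥ GT j) - GT i ⬝ᵥ (u *ᵥ FT j)) = 0) → w = 0 ∧ u = 0

theorem perturb {K : Type} [Field K] {E F : Type} [AddCommGroup E] [Module K E]
    [FiniteDimensional K E] [AddCommGroup F] [Module K F] (T0 T1 : E →ₗ[K] F)
    (h : ∀ e, T0 e = 0 → e = 0) :
    {ε : K | ¬ ∀ e, T0 e + ε • T1 e = 0 → e = 0}.Finite := by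
  obtain ⟨L, hL⟩ := T0.exists_leftInverse_of_injective (LinearMap.ker_eq_bot'.2 h)
  have hL' : ∀ e, L (T0 e) = e := fun e => by
    simpa using LinearMap.congr_fun hL e
  have hfin := Module.End.finite_hasEigenvalue (L ∘ₗ T1)
  refine (hfin.image (fun μ => - μ⁻¹)).subset ?_
  intro ε hε
  simp only [Set.mem_ofPred_eq, not_forall] at hε
  obtain ⟨e, he, hne⟩ := hε
  have h1 : e + ε • L (T1 e) = 0 := by
    have := congrArg L he
    simpa [hL'] using this
  have hε0 : ε ≠ 0 := by
    rintro rfl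
    apply hne; simpa using h1
  refine ⟨-ε⁻¹, ?_, by simp⟩
  refine Module.End.hasEigenvalue_of_hasEigenvector (x := e) ⟨?_, hne⟩
  rw [Module.End.mem_eigenspace_iff]
  have h2 : e = - (ε • L (T1 e)) := eq_neg_of_add_eq_zero_left h1
  simp only [LinearMap.comp_apply]
  conv_rhs => rw [h2]
  simp [smul_smul, hε0]

theorem alt_form {K : Type} [Field K] {R : Type} [Fintype R] {w : Matrix R R K}
    (hw : ∀ i j, w i j = - w j i) (x y : R → K) : x ⬝ᵥ (w *ᵥ y) = - (y ⬝ᵥ (w *ᵥ x)) := by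
  have : w = - wᵀ := by ext i j; simpa using hw i j
  conv_lhs => rw [this]
  rw [neg_mulVec, dotProduct_neg, mulVec_transpose, dotProduct_comm, dotProduct_mulVec]

theorem WedgeP.mono {K : Type} [Field K] {R A B A' B' : Type} [Fintype R]
    (h : WedgeP K R A B) (f : A → A') (g : B → B') (hf : f.Injective) (hg : g.Injective) :
    WedgeP K R A' B' := by
  obtain ⟨A1, A2, B1, B2, h⟩ := h
  refine ⟨f.extend A1 0, f.extend A2 0, g.extend B1 0, g.extend B2 0, fun w hw h0 => h w hw ?_⟩
  intro a b
  simpa [hf.extend_apply, hg.extend_apply] using h0 (f a) (g b)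

theorem WedgeP.congr {K : Type} [Field K] {R R' A B : Type} [Fintype R] [Fintype R']
    (h : WedgeP K R A B) (e : R' ≃ R) : WedgeP K R' A B := by
  obtain ⟨A1, A2, B1, B2, h⟩ := h
  refine ⟨fun a => A1 a ∘ e, fun a => A2 a ∘ e, fun a => B1 a ∘ e, fun a => B2 a ∘ e,
    fun w hw h0 => ?_⟩
  have key : ∀ (x y : R → K), (x ∘ e) ⬝ᵥ (w *ᵥ (y ∘ e)) =
      x ⬝ᵥ (w.submatrix e.symm e.symm *ᵥ y) := by
    intro x y
    simp only [dotProduct, mulVec, submatrix_apply, Function.comp]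
    rw [← e.sum_comp]
    refine Finset.sum_congr rfl fun i _ => ?_
    rw [← e.sum_comp]
    simp
  have := h (w.submatrix e.symm e.symm) (fun i j => hw _ _) (fun a b => by
    rw [← key, ← key]; exact h0 a b)
  ext i j
  simpa using congrFun (congrFun this (e i)) (e j)

theorem WedgeQ.mono {K : Type} [Field K] {M M' S T : Type} [Fintype S] [Fintype T]
    (h : WedgeQ K M S T) (f : M → M') (hf : f.Injective) : WedgeQ K M' S T := by
  obtain ⟨A1, A2, B1, B2, h⟩ := h
  refine ⟨f.extend A1 0, f.extend A2 0, f.extend B1 0, f.extend B2 0,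
    fun w u hw hu h0 => h w u hw hu ?_⟩
  intro a b
  simpa [hf.extend_apply] using h0 (f a) (f b)

theorem WedgeQ.toP {K : Type} [Field K] {M S T : Type} [Fintype S] [Fintype T] [Fintype M]
    [DecidableEq S] [DecidableEq T] [DecidableEq M]
    (h : WedgeQ K M S T) : WedgeP K (S ⊕ M ⊕ T) (S ⊕ M) (M ⊕ T) := by
  obtain ⟨FS, GS, FT, GT, h⟩ := h
  refine ⟨Sum.elim (fun s => Pi.single (.inl s) 1) (fun m => Pi.single (.inr (.inl m)) 1),
    Sum.elim 0 (fun m => Sum.elim (FS m) (Sum.elim 0 (FT m))),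
    Sum.elim (fun m => Pi.single (.inr (.inl m)) 1) (fun t => Pi.single (.inr (.inr t)) 1),
    Sum.elim (fun m => Sum.elim (GS m) (Sum.elim 0 (GT m))) 0, fun w hw h0 => ?_⟩
  have hSM : ∀ s m, w (.inl s) (.inr (.inl m)) = 0 := fun s m => by
    simpa using h0 (.inl s) (.inl m)
  have hST : ∀ s t, w (.inl s) (.inr (.inr t)) = 0 := fun s t => by
    simpa using h0 (.inl s) (.inr t)
  have hMT : ∀ m t, w (.inr (.inl m)) (.inr (.inr t)) = 0 := fun s t => by
    simpa using h0 (.inr s) (.inr t)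
  have hTS : ∀ s t, w (.inr (.inr t)) (.inl s) = 0 := fun s t => by rw [hw, hST, neg_zero]
  have hMM : ∀ m n, w (.inr (.inl m)) (.inr (.inl n)) +
      (FS m ⬝ᵥ ((Matrix.of fun i j => w (.inl i) (.inl j)) *ᵥ GS n) +
       FT m ⬝ᵥ ((Matrix.of fun i j => w (.inr (.inr i)) (.inr (.inr j))) *ᵥ GT n)) = 0 := by
    intro m n
    have := h0 (.inr m) (.inl n)
    simpa [dotProduct, mulVec, hST, hTS, Pi.single_apply] using this
  obtain ⟨h1, h2⟩ := h (Matrix.of fun i j => w (.inl i) (.inl j))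
    (Matrix.of fun i j => w (.inr (.inr i)) (.inr (.inr j))) (fun i j => hw _ _)
    (fun i j => hw _ _) (by
      intro i j
      have e1 := hMM i j
      have e2 := hMM j i
      rw [hw] at e2
      have e3 := alt_form (w := Matrix.of fun i j => w (.inl i) (.inl j))
        (fun i j => hw _ _) (FS j) (GS i)
      have e4 := alt_form (w := Matrix.of fun i j => w (.inr (.inr i)) (.inr (.inr j)))
        (fun i j => hw _ _) (FT j) (GT i)
      linear_combination e1 + e2 - e3 - e4)
  have hSS : ∀ i j, w (.inl i) (.inl j) = 0 := fun i j => congrFun (congrFun h1 i) j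
  have hTT : ∀ i j, w (.inr (.inr i)) (.inr (.inr j)) = 0 := fun i j => congrFun (congrFun h2 i) j
  have hMM' : ∀ i j, w (.inr (.inl i)) (.inr (.inl j)) = 0 := fun i j => by
    have := hMM i j
    rw [h1, h2] at this
    simpa using this
  ext i j
  rcases i with i | i | i <;> rcases j with j | j | j
  · exact hSS _ _
  · exact hSM _ _
  · exact hST _ _
  · rw [hw, hSM]; simp
  · exact hMM' _ _
  · exact hMT _ _
  · exact hTS _ _
  · rw [hw, hMT]; simp
  · exact hTT _ _

theorem hankel_zero {K : Type} [Field K] [CharZero K] {o : ℕ}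
    (w : Matrix (Fin (o+1)) (Fin (o+1)) K) (hw : ∀ i j, w i j = - w j i)
    (h : ∀ i j : Fin o, w i.succ j.castSucc = w i.castSucc j.succ) : w = 0 := by
  have key : ∀ (k i j : ℕ) (hi : i + k < o + 1) (hj : j + k < o + 1),
      w ⟨i + k, hi⟩ ⟨j, by omega⟩ = w ⟨i, by omega⟩ ⟨j + k, hj⟩ := by
    intro k
    induction k with
    | zero => intro i j hi hj; rfl
    | succ k ih =>
      intro i j hi hj
      have e1 := h ⟨i + k, by omega⟩ ⟨j, by omega⟩
      have e2 := ih i (j+1) (by omega) (by omega)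
      simp only [Fin.succ_mk, Fin.castSucc_mk] at e1
      have e3 : w ⟨i + (k+1), hi⟩ ⟨j, by omega⟩ = w ⟨i, by omega⟩ ⟨j + 1 + k, by omega⟩ := 
        e1.trans e2
      rw [e3]; congr 2; omega
  have half : ∀ i j : Fin (o+1), i ≤ j → w i j = 0 := by
    intro i j hij
    have e := key (j - i) i i (by omega) (by omega)
    have hj : (⟨i + (j - i : ℕ), by omega⟩ : Fin (o+1)) = j := by
      ext; simp; omega
    rw [hj] at e
    change w j i = w i j at e
    have := hw i j
    rw [e] at this
    exact self_eq_neg.1 this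
  ext i j
  rcases le_total i j with hij | hij
  · exact half i j hij
  · rw [hw, half j i hij]; simp

theorem WedgeP.generic {K : Type} [Field K] [CharZero K] {R A B : Type} [Fintype R]
    [Finite A] [Finite B] (z : R)
    (h : WedgeP K R A B) : 
  ∃ (A1 A2 : A → R → K) (B1 B2 : B → R → K), (∀ a, A1 a z ≠ 0) ∧ (∀ b, B2 b z ≠ 0) ∧
   ∀ w : Matrix R R K, (∀ i j, w i j = - w j i) →
    (∀ a b, A1 a ⬝ᵥ (w *ᵥ B1 b) + A2 a ⬝ᵥ (w *ᵥ B2 b) = 0) → w = 0 := by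
  obtain ⟨A1, A2, B1, B2, h⟩ := h
  let T0 : Matrix R R K →ₗ[K] (R → R → K) × (A → B → K) :=
    { toFun := fun w => (fun i j => w i j + w j i,
        fun a b => A1 a ⬝ᵥ (w *ᵥ B1 b) + A2 a ⬝ᵥ (w *ᵥ B2 b))
      map_add' := fun w v => by
        ext <;> simp [add_mulVec, dotProduct_add] <;> ring
      map_smul' := fun c w => by
        ext <;> simp [smul_mulVec, dotProduct_smul] <;> ring }
  let T1 : Matrix R R K →ₗ[K] (R → R → K) × (A → B → K) :=
    { toFun := fun w => (0,
        fun a b => (1 : R → K) ⬝ᵥ (w *ᵥ B1 b) + A2 a ⬝ᵥ (w *ᵥ 1))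
      map_add' := fun w v => by
        ext <;> simp [add_mulVec, dotProduct_add] <;> ring
      map_smul' := fun c w => by
        ext <;> simp [smul_mulVec, dotProduct_smul] <;> ring }
  have hfin := perturb T0 T1 (by
    intro w hw
    have h1 := congrArg Prod.fst hw
    have h2 := congrArg Prod.snd hw
    exact h w (fun i j => eq_neg_of_add_eq_zero_left (congrFun (congrFun h1 i) j))
      (fun a b => congrFun (congrFun h2 a) b))
  have f1 := Set.finite_range (fun a => - A1 a z)
  have f2 := Set.finite_range (fun b => - B2 b z)
  obtain ⟨ε, hε⟩ := ((hfin.union f1).union f2).exists_notMem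
  simp only [Set.mem_union, not_or, Set.mem_ofPred_eq, not_not, Set.mem_range, not_exists] at hε
  obtain ⟨⟨h1, h2⟩, h3⟩ := hε
  refine ⟨fun a => A1 a + ε • 1, A2, B1, fun b => B2 b + ε • 1, ?_, ?_, ?_⟩
  · intro a ha
    apply h2 a
    simp at ha
    linear_combination -ha
  · intro a ha
    apply h3 a
    simp at ha
    linear_combination -ha
  · intro w hw h0
    apply h1
    ext i j
    · simp only [T0, T1, LinearMap.coe_mk, AddHom.coe_mk, Prod.fst_add, Prod.smul_fst, Pi.add_apply,
        smul_zero, Prod.fst_zero, Pi.zero_apply, Pi.zero_apply, add_zero]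
      rw [hw i j]; ring
    · have := h0 i j
      simp only [mulVec_add, add_dotProduct, dotProduct_add, mulVec_smul, smul_dotProduct,
        dotProduct_smul, smul_eq_mul] at this
      simp [T0, T1]
      linear_combination this

theorem WedgeP.perturbed {K : Type} [Field K] [CharZero K] {o : ℕ} {A B : Type}
    [Finite A] [Finite B] (h : WedgeP K (Fin (o+1)) A B) (c : A → K) (c' : B → K)
    (hc : ∀ a, c a ≠ 0) (hc' : ∀ b, c' b ≠ 0) :
    ∃ (k φ' : A → Fin (o+1) → K) (k' φ : B → Fin (o+1) → K) (ε : K), ε ≠ 0 ∧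
      ∀ (w : Matrix (Fin (o+1)) (Fin (o+1)) K) (x : A → Fin (o+1) → K) (y : B → Fin (o+1) → K),
        (∀ i j, w i j = - w j i) →
        (∀ a (i : Fin o), c a * x a i.castSucc - (w *ᵥ k a) i.castSucc
          + ε * ((w *ᵥ φ' a) i.castSucc - x a i.succ) = 0) →
        (∀ a, k a ⬝ᵥ x a = 0) →
        (∀ b (i : Fin o), c' b * y b i.castSucc + (w *ᵥ k' b) i.castSucc
          + ε * (- (w *ᵥ φ b) i.castSucc - y b i.succ) = 0) →
        (∀ b, k' b ⬝ᵥ y b = 0) →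
        (∀ a b, x a ⬝ᵥ φ b + φ' a ⬝ᵥ y b = 0) → w = 0 ∧ x = 0 ∧ y = 0 := by
  obtain ⟨A1, A2, B1, B2, hA, hB, h⟩ := h.generic (Fin.last o)
  let T0 : (Matrix (Fin (o+1)) (Fin (o+1)) K × (A → Fin (o+1) → K) × (B → Fin (o+1) → K)) →ₗ[K]
      ((Fin (o+1) → Fin (o+1) → K) × (A → Fin o → K) × (A → K) × (B → Fin o → K) ×
      (B → K) × (A → B → K)) :=
    { toFun := fun e => (fun i j => e.1 i j + e.1 j i,
        fun a i => c a * e.2.1 a i.castSucc - (e.1 *ᵥ (c a • A1 a)) i.castSucc,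
        fun a => (c a • A1 a) ⬝ᵥ e.2.1 a,
        fun b i => c' b * e.2.2 b i.castSucc + (e.1 *ᵥ (c' b • B2 b)) i.castSucc,
        fun b => (c' b • B2 b) ⬝ᵥ e.2.2 b,
        fun a b => e.2.1 a ⬝ᵥ B1 b + A2 a ⬝ᵥ e.2.2 b)
      map_add' := fun w v => by
        ext <;> simp [add_mulVec, dotProduct_add, add_dotProduct, mulVec_smul] <;> ring
      map_smul' := fun c w => by
        ext <;> simp [smul_mulVec, dotProduct_smul, smul_dotProduct, mulVec_smul] <;> ring }
  let T1 : (Matrix (Fin (o+1)) (Fin (o+1)) K × (A → Fin (o+1) → K) × (B → Fin (o+1) → K)) →ₗ[K]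
      ((Fin (o+1) → Fin (o+1) → K) × (A → Fin o → K) × (A → K) × (B → Fin o → K) ×
      (B → K) × (A → B → K)) :=
    { toFun := fun e => (0,
        fun a i => (e.1 *ᵥ A2 a) i.castSucc - e.2.1 a i.succ,
        0,
        fun b i => - (e.1 *ᵥ B1 b) i.castSucc - e.2.2 b i.succ,
        0, 0)
      map_add' := fun w v => by
        ext <;> simp [add_mulVec] <;> ring
      map_smul' := fun c w => by
        ext <;> simp [smul_mulVec] <;> ring }
  have hfin := perturb T0 T1 (by
    rintro ⟨w, x, y⟩ he
    have h1 := congrArg (fun e => e.1) he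
    have h2 := congrArg (fun e => e.2.1) he
    have h3 := congrArg (fun e => e.2.2.1) he
    have h4 := congrArg (fun e => e.2.2.2.1) he
    have h5 := congrArg (fun e => e.2.2.2.2.1) he
    have h6 := congrArg (fun e => e.2.2.2.2.2) he
    have hw : ∀ i j, w i j = - w j i :=
      fun i j => eq_neg_of_add_eq_zero_left (congrFun (congrFun h1 i) j)
    have aux : ∀ (v k : Fin (o+1) → K), k (Fin.last o) ≠ 0 →
        (∀ i : Fin o, v i.castSucc - (w *ᵥ k) i.castSucc = 0) → k ⬝ᵥ v = 0 → v = w *ᵥ k := by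
      intro v k hk hv hkv
      have e0 : k ⬝ᵥ (w *ᵥ k) = 0 := self_eq_neg.1 (alt_form hw k k)
      have e1 : k ⬝ᵥ (v - w *ᵥ k) = 0 := by rw [dotProduct_sub, e0, hkv, sub_zero]
      have e2 : (v - w *ᵥ k) (Fin.last o) = 0 := by
        rw [dotProduct, Fin.sum_univ_castSucc] at e1
        simp only [Pi.sub_apply, hv, mul_zero, Finset.sum_const_zero, zero_add] at e1
        exact (mul_eq_zero.1 e1).resolve_left hk
      rw [← sub_eq_zero]
      ext i
      refine Fin.lastCases e2 (fun i => ?_) i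
      exact hv i
    have hx : ∀ a, x a = w *ᵥ A1 a := by
      intro a
      refine aux _ _ (hA a) (fun i => ?_) ?_
      · have := congrFun (congrFun h2 a) i
        simp [T0, mulVec_smul] at this
        rw [← mul_sub] at this
        exact (mul_eq_zero.1 this).resolve_left (hc a)
      · have := congrFun h3 a
        simp [T0, smul_dotProduct] at this
        exact this.resolve_left (hc a)
    have hy : ∀ b, - y b = w *ᵥ B2 b := by
      intro b
      refine aux _ _ (hB b) (fun i => ?_) ?_
      · have := congrFun (congrFun h4 b) i
        simp [T0, mulVec_smul] at this
        rw [← mul_add] at this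
        have := (mul_eq_zero.1 this).resolve_left (hc' b)
        simp only [Pi.neg_apply]
        linear_combination - this
      · have := congrFun h5 b
        simp [T0, smul_dotProduct] at this
        rw [dotProduct_neg, this.resolve_left (hc' b), neg_zero]
    have hy' : ∀ b, y b = - w *ᵥ B2 b := fun b => by rw [neg_mulVec, ← hy, neg_neg]
    have hw0 : w = 0 := by
      apply h w hw
      intro a b
      have := congrFun (congrFun h6 a) b
      simp only [T0, LinearMap.coe_mk, AddHom.coe_mk] at this
      rw [hx, hy', neg_mulVec, dotProduct_neg, dotProduct_comm, alt_form hw] at this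
      have e : -(A1 a ⬝ᵥ w *ᵥ B1 b) + -(A2 a ⬝ᵥ w *ᵥ B2 b) = 0 := this
      linear_combination - e
    have hx0 : x = 0 := by ext a i; rw [hx, hw0]; simp
    have hy0 : y = 0 := by ext a i; rw [hy', hw0]; simp
    rw [hw0, hx0, hy0]; rfl)
  obtain ⟨ε, hε⟩ := (hfin.union (Set.finite_singleton 0)).exists_notMem
  simp only [Set.mem_union, not_or, Set.mem_ofPred_eq, not_not, Set.mem_singleton_iff] at hε
  refine ⟨fun a => c a • A1 a, A2, fun b => c' b • B2 b, B1, ε, hε.2, ?_⟩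
  intro w x y hw h2 h3 h4 h5 h6
  have := hε.1 (w, x, y) (by
    refine Prod.ext ?_ (Prod.ext ?_ (Prod.ext ?_ (Prod.ext ?_ (Prod.ext ?_ ?_))))
    · ext i j
      simp [T0, T1]
      rw [hw i j]; ring
    · ext a i
      exact h2 a i
    · ext a
      simpa [T0, T1] using h3 a
    · ext a i
      exact h4 a i
    · ext a
      simpa [T0, T1] using h5 a
    · ext a b
      simpa [T0, T1] using h6 a b)
  simpa using this

theorem block_form {K : Type} [Field K] {A C : Type} [Fintype A] [Fintype C]
    (P : Matrix A A K) (X : Matrix A C K) (w : Matrix C C K) (p p' : A → K) (q q' : C → K) :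
    Sum.elim p q ⬝ᵥ (fromBlocks P X (-Xᵀ) w *ᵥ Sum.elim p' q') =
      p ⬝ᵥ (P *ᵥ p') + p ⬝ᵥ (X *ᵥ q') - p' ⬝ᵥ (X *ᵥ q) + q ⬝ᵥ (w *ᵥ q') := by
  have e1 : Sum.elim p' q' ∘ Sum.inl = p' := rfl
  have e2 : Sum.elim p' q' ∘ Sum.inr = q' := rfl
  have e3 : p' ⬝ᵥ (X *ᵥ q) = q ⬝ᵥ (Xᵀ *ᵥ p') := by
    rw [mulVec_transpose, dotProduct_comm q, dotProduct_mulVec]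
  rw [fromBlocks_mulVec, sumElim_dotProduct_sumElim, e1, e2, e3, dotProduct_add, dotProduct_add,
    neg_mulVec, dotProduct_neg]
  ring

theorem WedgeP.toQ {K : Type} [Field K] [CharZero K] {o : ℕ} {A B : Type}
    [Fintype A] [Fintype B] [DecidableEq A] [DecidableEq B]
    (h : WedgeP K (Fin (o+1)) A B) (c : A → K) (c' : B → K)
    (hc : ∀ a, c a ≠ 0) (hc' : ∀ b, c' b ≠ 0) (hci : c.Injective) (hci' : c'.Injective) :
    WedgeQ K (A ⊕ (Fin o ⊕ B)) (A ⊕ Fin (o+1)) (B ⊕ Fin (o+1)) := by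
  obtain ⟨k, φ', k', φ, ε, hε, h⟩ := h.perturbed c c' hc hc'
  refine ⟨
    Sum.elim (fun a => Sum.elim (Pi.single a (ε⁻¹ * c a)) (k a))
      (Sum.elim (fun i => Sum.elim 0 (Pi.single i.succ 1)) (fun b => Sum.elim 0 (ε • φ b))),
    Sum.elim (fun a => Sum.elim (Pi.single a 1) 0)
      (Sum.elim (fun i => Sum.elim 0 (Pi.single i.castSucc 1)) (fun _ => Sum.elim 0 0)),
    Sum.elim (fun a => Sum.elim 0 (ε • φ' a))
      (Sum.elim (fun i => Sum.elim 0 (Pi.single i.succ 1))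
        (fun b => Sum.elim (Pi.single b (ε⁻¹ * c' b)) (k' b))),
    Sum.elim (fun _ => Sum.elim 0 0)
      (Sum.elim (fun i => Sum.elim 0 (Pi.single i.castSucc 1))
        (fun b => Sum.elim (Pi.single b 1) 0)), ?_⟩
  intro W U hW hU h0
  obtain ⟨w, hw⟩ : ∃ w, w = W.toBlocks₂₂ := ⟨_, rfl⟩
  obtain ⟨X, hX⟩ : ∃ w, w = W.toBlocks₁₂ := ⟨_, rfl⟩
  obtain ⟨P, hP⟩ : ∃ w, w = W.toBlocks₁₁ := ⟨_, rfl⟩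
  obtain ⟨u, hu⟩ : ∃ w, w = U.toBlocks₂₂ := ⟨_, rfl⟩
  obtain ⟨Y, hY⟩ : ∃ w, w = U.toBlocks₁₂ := ⟨_, rfl⟩
  obtain ⟨Q, hQ⟩ : ∃ w, w = U.toBlocks₁₁ := ⟨_, rfl⟩
  have hWb : W = fromBlocks P X (-Xᵀ) w := by
    rw [← fromBlocks_toBlocks W, hw, hX, hP]
    congr 1
    ext i j; exact hW _ _
  have hUb : U = fromBlocks Q Y (-Yᵀ) u := by
    rw [← fromBlocks_toBlocks U, hu, hY, hQ]
    congr 1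
    ext i j; exact hU _ _
  have hwa : ∀ i j, w i j = - w j i := by intro i j; rw [hw]; exact hW _ _
  have hua : ∀ i j, u i j = - u j i := by intro i j; rw [hu]; exact hU _ _
  have hPa : ∀ i j, P i j = - P j i := by intro i j; rw [hP]; exact hW _ _
  have hQa : ∀ i j, Q i j = - Q j i := by intro i j; rw [hQ]; exact hU _ _
  clear hw hX hP hu hY hQ hW hU
  subst hWb hUb
  have hOO := fun i j => h0 (.inr (.inl i)) (.inr (.inl j))
  have hAO := fun a i => h0 (.inl a) (.inr (.inl i))
  have hBO := fun b i => h0 (.inr (.inr b)) (.inr (.inl i))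
  have hAB := fun a b => h0 (.inl a) (.inr (.inr b))
  have hAA := fun a b => h0 (.inl a) (.inl b)
  have hBB := fun a b => h0 (.inr (.inr a)) (.inr (.inr b))
  clear h0
  simp only [Sum.elim_inl, Sum.elim_inr, block_form] at hOO hAO hBO hAB hAA hBB
  simp at hOO hAO hBO hAB hAA hBB
  have hwu : w + u = 0 := by
    apply hankel_zero
    · intro i j
      simp only [Matrix.add_apply]
      rw [hwa i j, hua i j]; ring
    · intro i j
      simp only [Matrix.add_apply]
      linear_combination hOO i j
  have hu : u = - w := eq_neg_of_add_eq_zero_right hwu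
  subst hu
  have hsw : ∀ (v : Fin (o+1) → K) (i : Fin (o+1)), v ⬝ᵥ w.col i = - (w *ᵥ v) i := by
    intro v i
    have := alt_form hwa v (Pi.single i 1)
    simpa using this
  have hsw' : ∀ (v : Fin (o+1) → K) (i : Fin (o+1)), v ⬝ᵥ (-w).col i = (w *ᵥ v) i := by
    intro v i
    have e : (-w).col i = - w.col i := rfl
    rw [e, dotProduct_neg, hsw, neg_neg]
  simp only [hsw, hsw'] at hAO hBO
  have hXk : ∀ a, (X *ᵥ k a) a = 0 := by
    intro a
    have h2 : (2 : K) * (X *ᵥ k a) a = 0 := by linear_combination - hAA a a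
    exact (mul_eq_zero.1 h2).resolve_left two_ne_zero
  have hYk : ∀ a, (Y *ᵥ k' a) a = 0 := by
    intro a
    have h2 : (2 : K) * (Y *ᵥ k' a) a = 0 := by linear_combination - hBB a a
    exact (mul_eq_zero.1 h2).resolve_left two_ne_zero
  simp only [mulVec_smul, Pi.smul_apply, smul_eq_mul] at hAB
  obtain ⟨hw0, hX0, hY0⟩ := h w (fun a => ε⁻¹ • X a) (fun b => ε⁻¹ • Y b) hwa
    (by
      intro a i
      simp only [Pi.smul_apply, smul_eq_mul]
      have e : ε * (ε⁻¹ * X a i.succ) = X a i.succ := by field_simp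
      linear_combination hAO a i - e)
    (by
      intro a
      rw [dotProduct_smul, dotProduct_comm]
      change ε⁻¹ • (X *ᵥ k a) a = 0
      rw [hXk, smul_zero])
    (by
      intro a i
      simp only [Pi.smul_apply, smul_eq_mul]
      have e : ε * (ε⁻¹ * Y a i.succ) = Y a i.succ := by field_simp
      linear_combination hBO a i - e)
    (by
      intro a
      rw [dotProduct_smul, dotProduct_comm]
      change ε⁻¹ • (Y *ᵥ k' a) a = 0
      rw [hYk, smul_zero])
    (by
      intro a b
      rw [smul_dotProduct, dotProduct_smul, dotProduct_comm (φ' a)]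
      change ε⁻¹ * (X *ᵥ φ b) a + ε⁻¹ * (Y *ᵥ φ' a) b = 0
      have e : ε * ((X *ᵥ φ b) a + (Y *ᵥ φ' a) b) = 0 := by linear_combination - hAB a b
      rw [← mul_add, (mul_eq_zero.1 e).resolve_left hε, mul_zero])
  have hX00 : X = 0 := by
    ext a i
    have := congrFun (congrFun hX0 a) i
    simpa [hε] using this
  have hY00 : Y = 0 := by
    ext a i
    have := congrFun (congrFun hY0 a) i
    simpa [hε] using this
  subst hw0 hX00 hY00
  have hP0 : P = 0 := by
    ext i j
    by_cases hij : i = j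
    · subst hij; exact self_eq_neg.1 (hPa i i)
    · have e := hAA i j
      simp only [zero_mulVec, Pi.zero_apply] at e
      have e2 : (c i - c j) * (ε⁻¹ * P i j) = 0 := by linear_combination e
      have e3 := (mul_eq_zero.1 e2).resolve_left (sub_ne_zero.2 fun h => hij (hci h))
      exact (mul_eq_zero.1 e3).resolve_left (inv_ne_zero hε)
  have hQ0 : Q = 0 := by
    ext i j
    by_cases hij : i = j
    · subst hij; exact self_eq_neg.1 (hQa i i)
    · have e := hBB i j
      simp only [zero_mulVec, Pi.zero_apply] at e
      have e2 : (c' i - c' j) * (ε⁻¹ * Q i j) = 0 := by linear_combination e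
      have e3 := (mul_eq_zero.1 e2).resolve_left (sub_ne_zero.2 fun h => hij (hci' h))
      exact (mul_eq_zero.1 e3).resolve_left (inv_ne_zero hε)
  subst hP0 hQ0
  simp

theorem WedgeP.step {K : Type} [Field K] [CharZero K] {o p q r a b : ℕ}
    (h : WedgeP K (Fin (o+1)) (Fin p) (Fin q)) (e : ℕ)
    (hr : r = 2 * p + 2 * q + 3 * o + 2 + e) (ha : a = 2 * p + q + 2 * o + 1 + e)
    (hb : b = p + 2 * q + 2 * o + 1 + e) : WedgeP K (Fin r) (Fin a) (Fin b) := by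
  have cinj : ∀ n, (fun i : Fin n => ((i : ℕ) : K) + 1).Injective := by
    intro n i j hij
    have : ((i : ℕ) : K) = ((j : ℕ) : K) := by simpa using hij
    exact Fin.ext (by exact_mod_cast this)
  have cne : ∀ n, ∀ i : Fin n, ((i : ℕ) : K) + 1 ≠ 0 := fun n i => Nat.cast_add_one_ne_zero _
  have h1 := h.toQ (fun i => ((i : ℕ) : K) + 1) (fun i => ((i : ℕ) : K) + 1)
    (cne _) (cne _) (cinj _) (cinj _)
  have h2 := h1.mono (M' := (Fin p ⊕ (Fin o ⊕ Fin q)) ⊕ Fin e) Sum.inl Sum.inl_injective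
  have h3 := h2.toP
  have eR := Fintype.equivOfCardEq (α := Fin r) (β := (Fin p ⊕ Fin (o+1)) ⊕
    ((Fin p ⊕ (Fin o ⊕ Fin q)) ⊕ Fin e) ⊕ (Fin q ⊕ Fin (o+1))) (by simp; omega)
  have eA := Fintype.equivOfCardEq (α := (Fin p ⊕ Fin (o+1)) ⊕
    ((Fin p ⊕ (Fin o ⊕ Fin q)) ⊕ Fin e)) (β := Fin a) (by simp; omega)
  have eB := Fintype.equivOfCardEq (α := 
    ((Fin p ⊕ (Fin o ⊕ Fin q)) ⊕ Fin e) ⊕ (Fin q ⊕ Fin (o+1))) (β := Fin b) (by simp; omega)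
  exact (h3.congr eR).mono eA eB eA.injective eB.injective

theorem WedgeP.trivial {K : Type} [Field K] [CharZero K] {r : ℕ} (hr : r ≤ 1) (A B : Type) :
    WedgeP K (Fin r) A B := by
  refine ⟨0, 0, 0, 0, fun w hw _ => ?_⟩
  ext i j
  have : i = j := by apply Fin.ext; omega
  subst this
  exact self_eq_neg.1 (hw i i)

/-- The numerical content of the recursion, over the integers. -/
theorem numeric (r a b : ℤ) (hr : 2 ≤ r) (hb0 : 0 ≤ b) (hba : b ≤ a) (hab : a ≤ b + 1)
    (h : r * (r - 1) ≤ 2 * (a * b))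
    (hmin : (a = b ∧ 2 * (a * (a - 1)) < r * (r - 1)) ∨
      (a = b + 1 ∧ 2 * (b * b) < r * (r - 1))) :
    0 ≤ 3 * r - 2 * a - 2 * b - 1 ∧ 3 * r - 2 * a - 2 * b - 1 < r ∧
    0 ≤ 2 * a + b - 2 * r + 1 ∧ 0 ≤ a + 2 * b - 2 * r + 1 ∧
    (3 * r - 2 * a - 2 * b - 1 = 0 → 1 ≤ a + 2 * b - 2 * r + 1) := by
  have hb' : 0 ≤ a + 2 * b - 2 * r + 1 := by
    by_contra hc
    nlinarith [sq_nonneg (a - 2 * b)]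
  have hlt : 3 * r - 2 * a - 2 * b - 1 < r := by
    by_contra hc
    nlinarith [sq_nonneg (a - b)]
  have hr' : 0 ≤ 3 * r - 2 * a - 2 * b - 1 := by
    by_contra hc
    rcases hmin with ⟨h1, h2⟩ | ⟨h1, h2⟩
    · subst h1
      have : 3 * r ≤ 4 * a := by omega
      nlinarith
    · subst h1
      have : 3 * r ≤ 4 * b + 2 := by omega
      nlinarith
  refine ⟨hr', hlt, by omega, hb', ?_⟩
  intro h0
  by_contra hc
  have : a + 2 * b - 2 * r + 1 = 0 := by omega
  rcases hmin with ⟨h1, h2⟩ | ⟨h1, h2⟩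
  · subst h1
    nlinarith
  · subst h1
    nlinarith

theorem wedge_all (K : Type) [Field K] [CharZero K] : ∀ (n r a b : ℕ), r + a + b ≤ n →
    b ≤ a → a ≤ b + 1 → r * (r - 1) ≤ 2 * (a * b) → WedgeP K (Fin r) (Fin a) (Fin b) := by
  intro n
  induction n with
  | zero => intro r a b hn _ _ _; exact WedgeP.trivial (by omega) _ _
  | succ n ih =>
    intro r a b hn hba hab h
    by_cases hr : r ≤ 1
    · exact WedgeP.trivial hr _ _
    by_cases hmin : (a = b ∧ 2 * (a * (a - 1)) < r * (r - 1)) ∨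
      (a = b + 1 ∧ 2 * (b * b) < r * (r - 1))
    swap
    · rcases (by omega : a = b ∨ a = b + 1) with h1 | h1
      · have h2 : r * (r - 1) ≤ 2 * (a * (a - 1)) := by
          by_contra hc
          exact hmin (Or.inl ⟨h1, by omega⟩)
        have ha : a ≠ 0 := by
          rintro rfl
          have : 0 < r * (r - 1) := Nat.mul_pos (by omega) (by omega)
          omega
        exact (ih r a (a - 1) (by omega) (by omega) (by omega) h2).mono id
          (Fin.castLE (by omega)) Function.injective_id (Fin.castLE_injective _)
      · have h2 : r * (r - 1) ≤ 2 * (b * b) := by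
          by_contra hc
          exact hmin (Or.inr ⟨h1, by omega⟩)
        exact (ih r b b (by omega) (by omega) (by omega) h2).mono 
          (Fin.castLE (by omega)) id (Fin.castLE_injective _) Function.injective_id
    have hrc : ((r - 1 : ℕ) : ℤ) = r - 1 := by push_cast [show 1 ≤ r by omega]; ring
    have hZ : (r : ℤ) * (r - 1) ≤ 2 * (a * b) := by rw [← hrc]; exact_mod_cast h
    have hm : ((a : ℤ) = b ∧ 2 * ((a : ℤ) * (a - 1)) < r * (r - 1)) ∨
        ((a : ℤ) = b + 1 ∧ 2 * ((b : ℤ) * b) < r * (r - 1)) := by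
      rw [← hrc]
      rcases hmin with ⟨h1, h2⟩ | ⟨h1, h2⟩
      · left
        refine ⟨by exact_mod_cast h1, ?_⟩
        rcases Nat.eq_zero_or_pos a with h0 | h0
        · have h3 : 0 < r * (r - 1) := lt_of_le_of_lt (Nat.zero_le _) h2
          rw [h0, Nat.cast_zero, zero_mul, mul_zero]
          exact_mod_cast h3
        · rw [show (a : ℤ) - 1 = ((a - 1 : ℕ) : ℤ) by push_cast [h0]; ring]
          exact_mod_cast h2
      · right
        exact ⟨by exact_mod_cast h1, by exact_mod_cast h2⟩
    obtain ⟨n1, n2, n3, n4, n5⟩ := numeric r a b (by omega) (by omega) (by omega) (by omega) hZ hm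
    rcases n1.eq_or_lt with h0 | h0
    · have := n5 h0.symm
      obtain ⟨p, hp⟩ := Int.eq_ofNat_of_zero_le (a := 2 * a + b - 2 * r) (by omega)
      obtain ⟨q, hq⟩ := Int.eq_ofNat_of_zero_le (a := a + 2 * b - 2 * r) (by omega)
      exact (WedgeP.trivial (r := 0 + 1) le_rfl (Fin p) (Fin q)).step 1 (by omega) (by omega)
        (by omega)
    · obtain ⟨o, ho⟩ := Int.eq_ofNat_of_zero_le (a := 3 * r - 2 * a - 2 * b - 2) (by omega)
      obtain ⟨p, hp⟩ := Int.eq_ofNat_of_zero_le (a := 2 * a + b - 2 * r + 1) (by omega)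
      obtain ⟨q, hq⟩ := Int.eq_ofNat_of_zero_le (a := a + 2 * b - 2 * r + 1) (by omega)
      refine (ih (o + 1) p q (by omega) (by omega) (by omega) ?_).step 0 (by omega) (by omega)
        (by omega)
      zify
      simp only [Nat.add_sub_cancel]
      rw [← hp, ← hq, ← ho]
      linarith [hZ]

theorem exists_wedge_independent (K : Type) [Field K] [CharZero K]
    (r : ℕ) (hr : 2 ≤ r) (a b : ℕ)
    (ha : a = ⌈Real.sqrt (r * (r - 1) / 2 : ℕ)⌉₊)
    (hb : b = if r * (r - 1) / 2 ≤ a * (a - 1) then a - 1 else a) :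
    ∃ (X : Fin r → Matrix (Fin a) (Fin 2) K) (Y : Fin r → Matrix (Fin 2) (Fin b) K),
      LinearIndependent K
        (fun q : {q : Fin r × Fin r // q.2 < q.1} =>
          X q.1.1 * Y q.1.2 - X q.1.2 * Y q.1.1) := by
  have hev : 2 * (r * (r - 1) / 2) = r * (r - 1) :=
    Nat.mul_div_cancel' (Nat.even_mul_pred_self r).two_dvd
  have hP : WedgeP K (Fin r) (Fin a) (Fin b) := by
    have hle : r * (r - 1) / 2 ≤ a * a := by
      have h1 : Real.sqrt (r * (r - 1) / 2 : ℕ) ≤ (a : ℝ) := by rw [ha]; exact Nat.le_ceil _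
      have h2 := Real.sqrt_le_left (by positivity) |>.1 h1
      rw [sq] at h2
      exact_mod_cast h2
    apply wedge_all K _ r a b le_rfl
    · rw [hb]; split_ifs <;> omega
    · rw [hb]; split_ifs <;> omega
    · rw [← hev]
      apply Nat.mul_le_mul_left
      rw [hb]; split_ifs with hc
      · exact hc
      · exact hle
  obtain ⟨A1, A2, B1, B2, h⟩ := hP
  refine ⟨fun i => Matrix.of fun x t => if t = 0 then A1 x i else A2 x i,
    fun j => Matrix.of fun t y => if t = 0 then B1 y j else B2 y j, ?_⟩
  rw [Fintype.linearIndependent_iff]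
  intro g hg
  have hw := h (∑ q, g q • (Matrix.single q.1.1 q.1.2 1 - Matrix.single q.1.2 q.1.1 1)) (by
      intro i j
      simp only [Matrix.sum_apply, ← Finset.sum_neg_distrib, Matrix.smul_apply, Matrix.sub_apply,
        Matrix.single_apply, smul_eq_mul]
      refine Finset.sum_congr rfl fun q _ => ?_
      simp only [and_comm]
      ring) (by
      intro x y
      have := congrFun (congrFun hg x) y
      simp only [Matrix.sum_apply, Matrix.smul_apply, Matrix.sub_apply, Matrix.mul_apply,
        Fin.sum_univ_two, Matrix.of_apply, smul_eq_mul, Matrix.zero_apply] at this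
      rw [← this]
      simp only [Matrix.sum_mulVec, dotProduct_sum, ← Finset.sum_add_distrib]
      refine Finset.sum_congr rfl fun q _ => ?_
      have e : ∀ (v : Fin r → K) (i : Fin r) (t : K), v ⬝ᵥ Function.update 0 i t = v i * t :=
        fun v i t => dotProduct_single v t i
      simp [Matrix.smul_mulVec, Matrix.sub_mulVec, Matrix.single_mulVec, e]
      ring)
  rintro ⟨⟨i, j⟩, hij⟩
  have := congrFun (congrFun hw i) j
  simp only [Matrix.sum_apply, Matrix.smul_apply, Matrix.sub_apply, Matrix.single_apply,
    smul_eq_mul, Matrix.zero_apply] at this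
  rw [Finset.sum_eq_single ⟨(i, j), hij⟩] at this
  · have hne : j ≠ i := ne_of_lt hij
    simpa [hne] using this
  · rintro ⟨⟨i', j'⟩, hij'⟩ _ hne
    have h1 : ¬ (i' = i ∧ j' = j) := by
      rintro ⟨rfl, rfl⟩; exact hne rfl
    have h2 : ¬ (j' = i ∧ i' = j) := by
      rintro ⟨rfl, rfl⟩; exact lt_asymm hij hij'
    simp [h1, h2]
  · simp
end
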